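/- arXiv:1310.6009 — 10 statements merged into one kernel-verified Lean document; each statement's English description precedes it below -/
import Mathlib

section
/- Let F be a finite field and n ≥ 1. Every n×n matrix M over F (not necessarily invertible) can be written as a product of at most ⌊3n/2⌋ linear instructions, i.e. matrices over F each of which differs from the n×n identity matrix in at most one row. -/
/-- A linear instruction: an `n × n` matrix over `F` that differs from the identity
matrix in at most one row. -/
def Matrix.IsLinearInstruction {F : Type*} [Semiring F] {n : ℕ}
    (M : Matrix (Fin n) (Fin n) F) : Prop :=
  ∃ i : Fin n, ∀ j : Fin n, j ≠ i → M j = (1 : Matrix (Fin n) (Fin n) F) j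

namespace Matrix

variable {F : Type*} [Field F] {n : ℕ}

theorem isLinearInstruction_updateRow_one (i : Fin n) (v : Fin n → F) :
    ((1 : Matrix (Fin n) (Fin n) F).updateRow i v).IsLinearInstruction :=
  ⟨i, fun _ hj => updateRow_ne hj⟩

theorem mul_updateRow_one_apply (A : Matrix (Fin n) (Fin n) F) (i : Fin n) (v : Fin n → F)
    (k j : Fin n) :
    (A * (1 : Matrix (Fin n) (Fin n) F).updateRow i v) k j =
      A k i * v j + if j = i then 0 else A k j := by
  rw [mul_apply, Finset.sum_eq_add_sum_sdiff_singleton_of_mem (Finset.mem_univ i)]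
  congr 1
  · simp
  · trans ∑ l ∈ Finset.univ \ {i}, if l = j then A k l else 0
    · refine Finset.sum_congr rfl fun l hl => ?_
      have hl : l ≠ i := by simpa using hl
      simp [updateRow_ne hl, one_apply]
    · rw [Finset.sum_ite_eq']
      simp

/-- The rows of `M` outside `S` are those of the identity matrix. -/
def IsOneOutside (S : Finset (Fin n)) (M : Matrix (Fin n) (Fin n) F) : Prop :=
  ∀ k ∉ S, M k = (1 : Matrix (Fin n) (Fin n) F) k

theorem IsOneOutside.mem {S : Finset (Fin n)} {M : Matrix (Fin n) (Fin n) F}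
    (hM : M.IsOneOutside S) {k i : Fin n} (hki : k ≠ i) (h : M k i ≠ 0) : k ∈ S := by
  by_contra hk
  exact h (by rw [hM k hk, one_apply_ne hki])

/-- The Schur complement of `M` at the entry `(i, i)`, completed to a square matrix whose row `i`
is that of the identity matrix. -/
def pivot (M : Matrix (Fin n) (Fin n) F) (i : Fin n) : Matrix (Fin n) (Fin n) F :=
  of fun k j =>
    if k = i then (1 : Matrix (Fin n) (Fin n) F) k j
    else if j = i then M k i / M i i
    else M k j - M k i * M i j / M i i

theorem pivot_mul_updateRow (M : Matrix (Fin n) (Fin n) F) (i : Fin n)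
    (h : M i i ≠ 0 ∨ ∀ k, k ≠ i → M k i = 0) :
    M.pivot i * (1 : Matrix (Fin n) (Fin n) F).updateRow i (M i) = M := by
  ext k j
  rw [mul_updateRow_one_apply]
  by_cases hk : k = i
  · subst hk
    by_cases hj : j = k
    · simp [pivot, hj]
    · simp [pivot, hj, one_apply_ne' hj]
  · rcases h with h | h
    · by_cases hj : j = i
      · subst hj
        simp [pivot, hk, h]
      · simp only [pivot, of_apply, hk, hj, if_false, if_true]
        field_simp
        ring
    · have := h k hk
      by_cases hj : j = i
      · subst hj
        simp [pivot, hk, this]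
      · simp [pivot, hk, hj, this]

theorem IsOneOutside.pivot {S : Finset (Fin n)} {M : Matrix (Fin n) (Fin n) F}
    (hM : M.IsOneOutside S) (i : Fin n) : (M.pivot i).IsOneOutside (S.erase i) := by
  intro k hk
  ext j
  by_cases hki : k = i
  · subst hki
    simp [Matrix.pivot]
  · have hkS : k ∉ S := fun h => hk (Finset.mem_erase.2 ⟨hki, h⟩)
    by_cases hj : j = i
    · simp [Matrix.pivot, hki, hj, hM k hkS]
    · simp [Matrix.pivot, hki, hj, hM k hkS]

/-- Subtract column `i` of `M` from every other column. -/
def subCol (M : Matrix (Fin n) (Fin n) F) (i : Fin n) : Matrix (Fin n) (Fin n) F :=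
  of fun k j => if j = i then M k i else M k j - M k i

theorem subCol_mul_updateRow (M : Matrix (Fin n) (Fin n) F) (i : Fin n) :
    M.subCol i * (1 : Matrix (Fin n) (Fin n) F).updateRow i 1 = M := by
  ext k j
  rw [mul_updateRow_one_apply]
  by_cases hj : j = i <;> simp [subCol, hj]

theorem IsOneOutside.subCol {S : Finset (Fin n)} {M : Matrix (Fin n) (Fin n) F}
    (hM : M.IsOneOutside S) {i : Fin n} (hi : i ∈ S) : (M.subCol i).IsOneOutside S := by
  intro k hk
  have hki : k ≠ i := fun h => hk (h ▸ hi)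
  ext j
  by_cases hj : j = i <;> simp [Matrix.subCol, hj, hM k hk, hki]

/-- `M` is a product of at most `m` linear instructions. -/
def IsInstructionProduct (m : ℕ) (M : Matrix (Fin n) (Fin n) F) : Prop :=
  ∃ L : List (Matrix (Fin n) (Fin n) F),
    L.length ≤ m ∧ (∀ A ∈ L, A.IsLinearInstruction) ∧ L.prod = M

theorem IsInstructionProduct.mono {m m' : ℕ} {M : Matrix (Fin n) (Fin n) F}
    (hM : M.IsInstructionProduct m) (h : m ≤ m') : M.IsInstructionProduct m' := by
  obtain ⟨L, hL, hL'⟩ := hM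
  exact ⟨L, hL.trans h, hL'⟩

theorem IsInstructionProduct.mul_updateRow {m : ℕ} {M : Matrix (Fin n) (Fin n) F}
    (hM : M.IsInstructionProduct m) (i : Fin n) (v : Fin n → F) :
    (M * (1 : Matrix (Fin n) (Fin n) F).updateRow i v).IsInstructionProduct (m + 1) := by
  obtain ⟨L, hL, hA, rfl⟩ := hM
  refine ⟨L ++ [(1 : Matrix (Fin n) (Fin n) F).updateRow i v], by simpa using hL, ?_, by simp⟩
  intro A h
  rcases List.mem_append.1 h with h | h
  · exact hA A h
  · rw [List.mem_singleton.1 h]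
    exact isLinearInstruction_updateRow_one i v

theorem IsInstructionProduct.of_pivot {m : ℕ} {M : Matrix (Fin n) (Fin n) F} {i : Fin n}
    (h : M i i ≠ 0 ∨ ∀ k, k ≠ i → M k i = 0) (hM : (M.pivot i).IsInstructionProduct m) :
    M.IsInstructionProduct (m + 1) :=
  M.pivot_mul_updateRow i h ▸ hM.mul_updateRow i (M i)

/-- With zero diagonal, a two-cycle or a path of length two among the nonzero entries yields
two successive nonzero pivots after one column subtraction. -/
theorem exists_pivots {M : Matrix (Fin n) (Fin n) F}
    {S : Finset (Fin n)} (hM : M.IsOneOutside S) (hS : S.Nonempty)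
    (hdiag : ∀ i ∈ S, M i i = 0) (hcol : ∀ i ∈ S, ∃ k, k ≠ i ∧ M k i ≠ 0) :
    ∃ i ∈ S, ∃ j ∈ S, ∃ k ∈ S, j ≠ k ∧ (M.subCol i) j j ≠ 0 ∧
      ((M.subCol i).pivot j) k k ≠ 0 := by
  have two_cycle : ∀ i ∈ S, ∀ j ∈ S, j ≠ i → M j i ≠ 0 → M i j ≠ 0 →
      (M.subCol i) j j ≠ 0 ∧ ((M.subCol i).pivot j) i i ≠ 0 := by
    intro i hi j hj hji h h'
    simp [subCol, pivot, hji, hji.symm, h, h', hdiag i hi, hdiag j hj]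
  obtain ⟨i, hi⟩ := hS
  obtain ⟨j, hji, h⟩ := hcol i hi
  have hj := hM.mem hji h
  obtain ⟨k, hkj, h'⟩ := hcol j hj
  have hk := hM.mem hkj h'
  by_cases hki : k = i
  · subst hki
    exact ⟨k, hi, j, hj, k, hk, hji, two_cycle k hi j hj hji h h'⟩
  by_cases hjk : M j k = 0
  · refine ⟨i, hi, j, hj, k, hk, hkj.symm, ?_, ?_⟩
    · simp [subCol, hji, h, hdiag j hj]
    · simp only [subCol, pivot, of_apply, hji, hki, hkj, hjk, hdiag j hj, hdiag k hk, if_false]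
      field_simp
      contrapose! h'
      linear_combination -h'
  · exact ⟨j, hj, k, hk, j, hj, hkj, two_cycle j hj k hk hkj h' hjk⟩

theorem IsOneOutside.isInstructionProduct (S : Finset (Fin n)) :
    ∀ M : Matrix (Fin n) (Fin n) F, M.IsOneOutside S →
      M.IsInstructionProduct (3 * S.card / 2) := by
  induction S using Finset.strongInduction with
  | H S ih =>
    intro M hM
    rcases S.eq_empty_or_nonempty with rfl | hS
    · exact ⟨[], by simp, by simp, (funext fun k => hM k (by simp)).symm⟩
    by_cases h : ∃ i ∈ S, M i i ≠ 0 ∨ ∀ k, k ≠ i → M k i = 0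
    · obtain ⟨i, hi, h⟩ := h
      have hcard := Finset.card_erase_add_one hi
      exact (IsInstructionProduct.of_pivot h
        (ih _ (Finset.erase_ssubset hi) _ (hM.pivot i))).mono (by omega)
    · push Not at h
      obtain ⟨i, hi, j, hj, k, hk, hjk, h₁, h₂⟩ := exists_pivots hM hS
        (fun i hi => (h i hi).1) (fun i hi => (h i hi).2)
      have hk' : k ∈ S.erase j := Finset.mem_erase.2 ⟨hjk.symm, hk⟩
      have hcard := Finset.card_erase_add_one hj
      have hcard' := Finset.card_erase_add_one hk'
      have hprod := ((IsInstructionProduct.of_pivot (.inl h₁) (.of_pivot (.inl h₂)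
        (ih _ ((Finset.erase_ssubset hk').trans (Finset.erase_ssubset hj)) _
          (((hM.subCol hi).pivot j).pivot k)))).mul_updateRow i 1)
      rw [subCol_mul_updateRow] at hprod
      exact hprod.mono (by omega)

end Matrix

/-- Every `n × n` matrix over a finite field `F` is a product of at most `⌊3n/2⌋`
linear instructions. -/
theorem every_matrix_is_product_of_instructions
    (F : Type*) [Field F] [Fintype F] (n : ℕ) (hn : 1 ≤ n)
    (M : Matrix (Fin n) (Fin n) F) :
    ∃ L : List (Matrix (Fin n) (Fin n) F),
      L.length ≤ 3 * n / 2 ∧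
      (∀ A ∈ L, A.IsLinearInstruction) ∧
      L.prod = M := by
  simpa [Matrix.IsInstructionProduct] using Matrix.IsOneOutside.isInstructionProduct Finset.univ M
    (fun k hk => absurd (Finset.mem_univ k) hk)
end

section
/- Let F be a finite field and n ≥ 2. There exists an invertible n×n matrix M over F that cannot be written as a product of fewer than ⌊3n/2⌋ bijective linear instructions; hence the bound ⌊3n/2⌋ on the maximum complexity in GL(n,F) is tight. -/
section LinearInstructions

variable {F : Type*} [Field F] {n : ℕ}

/-- Multiplying on the left by an instruction updating row `i` leaves the other rows unchanged. -/
lemma mul_row_of_row_eq_one {A : Matrix (Fin n) (Fin n) F} {j : Fin n}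
    (hA : A j = (1 : Matrix (Fin n) (Fin n) F) j) (B : Matrix (Fin n) (Fin n) F) :
    (A * B) j = B j := by
  rw [Matrix.mul_apply_eq_vecMul, hA, ← Matrix.mul_apply_eq_vecMul, Matrix.one_mul]

/-- A row that no factor of `L` updates is the same in `L.prod * B` as in `B`. -/
lemma list_prod_mul_row {r : Matrix (Fin n) (Fin n) F → Fin n}
    {L : List (Matrix (Fin n) (Fin n) F)}
    (hr : ∀ A ∈ L, ∀ j, j ≠ r A → A j = (1 : Matrix (Fin n) (Fin n) F) j)
    {j : Fin n} (hj : ∀ A ∈ L, j ≠ r A) (B : Matrix (Fin n) (Fin n) F) :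
    (L.prod * B) j = B j := by
  induction L with
  | nil => simp
  | cons A L ih =>
    rw [List.prod_cons, Matrix.mul_assoc,
      mul_row_of_row_eq_one (hr A List.mem_cons_self j (hj A List.mem_cons_self))]
    exact ih (fun A hA => hr A (List.mem_cons_of_mem _ hA))
      fun A hA => hj A (List.mem_cons_of_mem _ hA)

lemma list_prod_row {r : Matrix (Fin n) (Fin n) F → Fin n}
    {L : List (Matrix (Fin n) (Fin n) F)}
    (hr : ∀ A ∈ L, ∀ j, j ≠ r A → A j = (1 : Matrix (Fin n) (Fin n) F) j)
    {j : Fin n} (hj : ∀ A ∈ L, j ≠ r A) :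
    L.prod j = (1 : Matrix (Fin n) (Fin n) F) j := by
  simpa using list_prod_mul_row hr hj 1

/-- A list with an element satisfying `p` can be split at the last such element. -/
lemma List.exists_eq_append_cons_last {α : Type*} {p : α → Prop} {L : List α}
    (h : ∃ a ∈ L, p a) :
    ∃ L₁ a L₂, L = L₁ ++ a :: L₂ ∧ p a ∧ ∀ b ∈ L₂, ¬ p b := by
  induction L with
  | nil => simp at h
  | cons c L ih =>
    by_cases hL : ∃ a ∈ L, p a
    · obtain ⟨L₁, a, L₂, rfl, ha, hb⟩ := ih hL
      exact ⟨c :: L₁, a, L₂, rfl, ha, hb⟩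
    · push Not at hL
      obtain ⟨a, ha, hpa⟩ := h
      rcases List.mem_cons.1 ha with rfl | ha
      · exact ⟨[], a, L, rfl, hpa, hL⟩
      · exact absurd hpa (hL a ha)

lemma one_row_injective :
    Function.Injective fun i => (1 : Matrix (Fin n) (Fin n) F) i := by
  intro i j h
  by_contra hij
  have := congrFun h i
  simp [Ne.symm hij] at this

/-- If a product of bijective instructions is the permutation matrix of a fixed-point-free `σ`,
then every nonempty set stable under `σ` contains a row that is updated at least twice. -/
lemma exists_two_le_count {σ : Equiv.Perm (Fin n)} (hσ : ∀ i, σ i ≠ i)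
    {r : Matrix (Fin n) (Fin n) F → Fin n} {L : List (Matrix (Fin n) (Fin n) F)}
    (hu : ∀ A ∈ L, IsUnit A)
    (hr : ∀ A ∈ L, ∀ j, j ≠ r A → A j = (1 : Matrix (Fin n) (Fin n) F) j)
    (hL : ∀ i, L.prod i = (1 : Matrix (Fin n) (Fin n) F) (σ i))
    {C : Set (Fin n)} (hC : C.Nonempty) (hσC : ∀ i ∈ C, σ i ∈ C) :
    ∃ i ∈ C, 2 ≤ (L.map r).count i := by
  have hex : ∃ A ∈ L, r A ∈ C := by
    by_contra! h
    obtain ⟨i, hi⟩ := hC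
    refine hσ i (one_row_injective (F := F) ?_)
    exact (hL i).symm.trans (list_prod_row hr fun A hA e => h A hA (e ▸ hi))
  obtain ⟨L₁, A, L₂, rfl, hA, hL₂⟩ := List.exists_eq_append_cons_last hex
  refine ⟨r A, hA, ?_⟩
  by_contra! hcount
  have hL₁ : ∀ B ∈ L₁, r A ≠ r B := by
    intro B hB e
    have hpos : 0 < (L₁.map r).count (r A) :=
      List.count_pos_iff.2 (e ▸ List.mem_map_of_mem hB)
    simp only [List.map_append, List.map_cons, List.count_append, List.count_cons_self] at hcount
    omega
  have hrow : (A * L₂.prod) (r A) = (1 : Matrix (Fin n) (Fin n) F) (σ (r A)) := by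
    rw [← hL, List.prod_append, List.prod_cons]
    exact (list_prod_mul_row (fun B hB => hr B (by simp [hB])) hL₁ _).symm
  have hrow' : (A * L₂.prod) (σ (r A)) = (1 : Matrix (Fin n) (Fin n) F) (σ (r A)) := by
    rw [mul_row_of_row_eq_one (hr A (by simp) _ (hσ _))]
    exact list_prod_row (fun B hB => hr B (by simp [hB]))
      fun B hB e => hL₂ B hB (e ▸ hσC _ hA)
  have hunit : IsUnit (A * L₂.prod) :=
    (hu A (by simp)).mul (List.prod_induction _ (fun _ _ => IsUnit.mul) isUnit_one
      fun B hB => hu B (by simp [hB]))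
  rw [Matrix.isUnit_iff_isUnit_det] at hunit
  exact hunit.ne_zero (Matrix.det_zero_of_row_eq (hσ (r A)).symm (hrow.trans hrow'.symm))

/-- If the fixed-point-free `σ` stabilises the fibres of a surjection onto `m` points, then its
permutation matrix is not a product of fewer than `n + m` bijective instructions. -/
lemma add_le_length_of_prod_eq {σ : Equiv.Perm (Fin n)} (hσ : ∀ i, σ i ≠ i) {m : ℕ}
    {f : Fin n → Fin m} (hf : Function.Surjective f) (hfσ : ∀ i, f (σ i) = f i)
    {L : List (Matrix (Fin n) (Fin n) F)}
    (hinstr : ∀ A ∈ L, IsUnit A ∧ A.IsLinearInstruction)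
    (hL : ∀ i, L.prod i = (1 : Matrix (Fin n) (Fin n) F) (σ i)) :
    n + m ≤ L.length := by
  rcases Nat.eq_zero_or_pos n with rfl | hn
  · have : m = 0 := by
      by_contra hm
      obtain ⟨i, -⟩ := hf ⟨0, Nat.pos_of_ne_zero hm⟩
      exact i.elim0
    omega
  have hchoice : ∀ A : Matrix (Fin n) (Fin n) F, ∃ i : Fin n,
      A ∈ L → ∀ j, j ≠ i → A j = (1 : Matrix (Fin n) (Fin n) F) j := by
    intro A
    by_cases hA : A ∈ L
    · obtain ⟨i, hi⟩ := (hinstr A hA).2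
      exact ⟨i, fun _ => hi⟩
    · exact ⟨⟨0, hn⟩, fun h => absurd h hA⟩
  choose r hr using hchoice
  have hone : ∀ i, 1 ≤ (L.map r).count i := by
    intro i
    rw [Nat.one_le_iff_ne_zero, ← Nat.pos_iff_ne_zero, List.count_pos_iff]
    by_contra h
    refine hσ i (one_row_injective (F := F) ?_)
    exact (hL i).symm.trans
      (list_prod_row hr fun A hA e => h (e ▸ List.mem_map_of_mem hA))
  have htwo : ∀ k, ∃ i, f i = k ∧ 2 ≤ (L.map r).count i := fun k =>
    exists_two_le_count hσ (fun A hA => (hinstr A hA).1) hr hL (C := {i | f i = k}) (hf k)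
      fun i hi => (hfσ i).trans hi
  choose g hfg hg using htwo
  have hm : m ≤ (Finset.univ.filter fun i => 2 ≤ (L.map r).count i).card := by
    have hinj : Function.Injective g := Function.LeftInverse.injective hfg
    calc m = (Finset.univ.image g).card := by
          rw [Finset.card_image_of_injective _ hinj, Finset.card_fin]
      _ ≤ _ := Finset.card_le_card fun i hi => by
          obtain ⟨k, -, rfl⟩ := Finset.mem_image.1 hi
          simpa using hg k
  calc n + m ≤ ∑ i : Fin n, (1 + if 2 ≤ (L.map r).count i then 1 else 0) := by
        rw [Finset.sum_add_distrib, ← Finset.card_filter]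
        simpa using hm
    _ ≤ ∑ i : Fin n, (L.map r).count i := Finset.sum_le_sum fun i _ => by
        have := hone i
        split_ifs <;> omega
    _ = L.length := by
        simpa using Multiset.sum_count_eq_card (s := Finset.univ) (m := (L.map r : Multiset (Fin n)))
          fun _ _ => Finset.mem_univ _

end LinearInstructions

/-- For `n ≥ 2`, some fixed-point-free permutation stabilises `⌊n/2⌋` disjoint nonempty classes:
transpositions of consecutive elements, with one final 3-cycle if `n` is odd. -/
lemma exists_perm_with_half_classes {n : ℕ} (hn : 2 ≤ n) :
    ∃ (σ : Equiv.Perm (Fin n)) (f : Fin n → Fin (n / 2)),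
      (∀ i, σ i ≠ i) ∧ Function.Surjective f ∧ ∀ i, f (σ i) = f i := by
  let s : Fin n → Fin n := fun i =>
    ⟨if i.1 % 2 = 0 then (if i.1 + 1 < n then i.1 + 1 else i.1 - 2)
      else (if i.1 + 2 = n then i.1 + 1 else i.1 - 1), by split_ifs <;> omega⟩
  have hs : Function.Injective s := by
    intro i j h
    simp only [s, Fin.mk.injEq] at h
    apply Fin.ext
    split_ifs at h <;> omega
  refine ⟨Equiv.ofBijective s (Finite.injective_iff_bijective.1 hs),
    fun i => ⟨min (i.1 / 2) (n / 2 - 1), by omega⟩, fun i h => ?_, fun k => ?_, fun i => ?_⟩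
  · have h := congrArg Fin.val h
    simp only [Equiv.ofBijective_apply, s] at h
    split_ifs at h <;> omega
  · refine ⟨⟨2 * k.1, by omega⟩, Fin.ext ?_⟩
    simp only
    omega
  · simp only [Equiv.ofBijective_apply, s, Fin.mk.injEq]
    split_ifs <;> omega

/-- For `n ≥ 2`, there is an invertible `n × n` matrix over a finite field `F` that is
not a product of fewer than `⌊3n/2⌋` bijective linear instructions: the bound `⌊3n/2⌋`
is tight. -/
theorem exists_matrix_requiring_three_halves_n_instructions
    (F : Type*) [Field F] [Fintype F] (n : ℕ) (hn : 2 ≤ n) :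
    ∃ M : Matrix (Fin n) (Fin n) F, IsUnit M ∧
      ∀ L : List (Matrix (Fin n) (Fin n) F),
        (∀ A ∈ L, IsUnit A ∧ A.IsLinearInstruction) → L.prod = M →
        3 * n / 2 ≤ L.length := by
  obtain ⟨σ, f, hσ, hf, hfσ⟩ := exists_perm_with_half_classes hn
  refine ⟨(1 : Matrix (Fin n) (Fin n) F).submatrix σ (Equiv.refl (Fin n)),
    (Matrix.isUnit_submatrix_equiv σ (Equiv.refl (Fin n))).2 isUnit_one, fun L hinstr hL => ?_⟩
  have := add_le_length_of_prod_eq hσ hf hfσ hinstr fun i => by rw [hL]; rfl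
  omega
end

section
/- Let F be a finite field with |F| > 2 and let α ∈ F with α ≠ 0 and α ≠ 1. The diagonal matrix diag(α, α⁻¹) (which has determinant 1) can be written as a product of two invertible 2×2 matrices over F each differing from the identity in at most one row; but it cannot be written as a product of at most two matrices of determinant 1 each differing from the identity in at most one row. Consequently SL(2,F) is not fast in GL(2,F). -/
/-- A `2 × 2` linear instruction of determinant `1` is unitriangular (upper or lower). -/
theorem Matrix.IsLinearInstruction.eq_unitriangular {F : Type*} [CommRing F]
    {A : Matrix (Fin 2) (Fin 2) F} (hA : A.IsLinearInstruction) (hdet : A.det = 1) :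
    ∃ b : F, A = !![1, b; 0, 1] ∨ A = !![1, 0; b, 1] := by
  obtain ⟨i, hi⟩ := hA
  rw [Matrix.det_fin_two] at hdet
  fin_cases i
  · have h := hi 1 (by simp)
    have h0 : A 1 0 = 0 := by simp [h]
    have h1 : A 1 1 = 1 := by simp [h]
    have h2 : A 0 0 = 1 := by simpa [h0, h1] using hdet
    exact ⟨A 0 1, Or.inl (by rw [A.eta_fin_two, h0, h1, h2]; simp)⟩
  · have h := hi 0 (by simp)
    have h0 : A 0 0 = 1 := by simp [h]
    have h1 : A 0 1 = 0 := by simp [h]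
    have h2 : A 1 1 = 1 := by simpa [h0, h1] using hdet
    exact ⟨A 1 0, Or.inr (by rw [A.eta_fin_two, h0, h1, h2]; simp)⟩

/-- For `|F| > 2` and `α ≠ 0, 1`, the matrix `diag(α, α⁻¹)` is a product of two
bijective linear instructions, but is not a product of at most two linear instructions
of determinant `1`.  Hence `SL(2, F)` is not fast in `GL(2, F)`. -/
theorem SL2_not_fast_in_GL2
    (F : Type*) [Field F] [Fintype F] (hF : 2 < Fintype.card F)
    (α : F) (hα0 : α ≠ 0) (hα1 : α ≠ 1) :
    (∃ A B : Matrix (Fin 2) (Fin 2) F,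
        IsUnit A ∧ A.IsLinearInstruction ∧ IsUnit B ∧ B.IsLinearInstruction ∧
        A * B = !![α, 0; 0, α⁻¹]) ∧
    ¬ ∃ L : List (Matrix (Fin 2) (Fin 2) F),
        L.length ≤ 2 ∧ (∀ A ∈ L, A.det = 1 ∧ A.IsLinearInstruction) ∧
        L.prod = !![α, 0; 0, α⁻¹] := by
  refine ⟨⟨!![α, 0; 0, 1], !![1, 0; 0, α⁻¹], ?_, ⟨0, ?_⟩, ?_, ⟨1, ?_⟩, ?_⟩, ?_⟩
  · simp [Matrix.isUnit_iff_isUnit_det, Matrix.det_fin_two, hα0]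
  · intro j hj
    fin_cases j
    · simp at hj
    · ext k; fin_cases k <;> simp
  · simp [Matrix.isUnit_iff_isUnit_det, Matrix.det_fin_two, hα0]
  · intro j hj
    fin_cases j
    · ext k; fin_cases k <;> simp
    · simp at hj
  · simp
  · rintro ⟨L, hlen, hL, hprod⟩
    match L, hlen with
    | [], _ =>
      have h := congrFun (congrFun hprod 0) 0
      simp at h
      exact hα1 h.symm
    | [A], _ =>
      obtain ⟨hdet, hA⟩ := hL A (by simp)
      obtain ⟨a, rfl | rfl⟩ := hA.eq_unitriangular hdet <;>
      · have h := congrFun (congrFun hprod 0) 0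
        simp at h
        exact hα1 h.symm
    | [A, B], _ =>
      obtain ⟨hdetA, hA⟩ := hL A (by simp)
      obtain ⟨hdetB, hB⟩ := hL B (by simp)
      obtain ⟨a, rfl | rfl⟩ := hA.eq_unitriangular hdetA <;>
      obtain ⟨b, rfl | rfl⟩ := hB.eq_unitriangular hdetB <;>
      · have h00 := congrFun (congrFun hprod 0) 0
        have h01 := congrFun (congrFun hprod 0) 1
        have h10 := congrFun (congrFun hprod 1) 0
        simp at h00 h01 h10
        grind
end

section
/- Let F be a finite field and n ≥ 2, and suppose it is not the case that n = 2, F has characteristic 2 and |F| ≥ 4. Then there exists a set of n matrices over F, each of determinant 1 and each differing from the n×n identity matrix in at most one row, which generates the special linear group SL(n,F). -/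
open Matrix

namespace Matrix.SpecialLinearGroup

open MatrixGroups

section Elementary

variable {ι F : Type*} [DecidableEq ι] [Fintype ι]

theorem transvection_commutator [CommRing F] {i j k : ι} (hij : i ≠ j) (hjk : j ≠ k)
    (hik : i ≠ k) (x y : F) :
    transvection hij x * transvection hjk y * (transvection hij x)⁻¹ * (transvection hjk y)⁻¹ =
      transvection hik (x * y) := by
  rw [mul_inv_eq_iff_eq_mul, mul_inv_eq_iff_eq_mul]
  apply Subtype.ext
  simp [transvection_coe, mul_add, add_mul, hjk.symm, hik.symm]
  abel

theorem diag2n_eq_transvection_prod [Field F] {i j : ι} (hij : i ≠ j) (a : F) (ha : a ≠ 0) :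
    diag2n hij a ha = transvection hij a * transvection hij.symm (-a⁻¹) * transvection hij a *
      transvection hij (-1) * transvection hij.symm 1 * transvection hij (-1) := by
  have hd : diagonal (fun k ↦ if k = i then a else if k = j then a⁻¹ else 1) =
      (1 : Matrix ι ι F) + single i i (a - 1) + single j j (a⁻¹ - 1) := by
    ext k l
    by_cases hkl : k = l
    · subst hkl
      simp only [diagonal_apply_eq, add_apply, one_apply_eq, single_apply]
      grind
    · simp only [diagonal_apply_ne _ hkl, add_apply, one_apply_ne hkl, single_apply]
      grind
  apply Subtype.ext
  rw [diag2n_coe, hd]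
  simp only [coe_mul, transvection_coe, mul_add, add_mul, mul_one, one_mul, single_mul_single_same,
    single_mul_single_of_ne _ _ _ _ hij, single_mul_single_of_ne _ _ _ _ hij.symm, add_zero]
  ext k l
  simp only [add_apply, single_apply]
  grind

theorem subgroup_eq_top_of_transvection_mem [Field F] [Nontrivial ι]
    (G : Subgroup (SpecialLinearGroup ι F))
    (h : ∀ (i j : ι) (hij : i ≠ j) (x : F), transvection hij x ∈ G) : G = ⊤ := by
  refine (Subgroup.eq_top_iff' G).2 fun M ↦
    diagonal_transvection_induction' (· ∈ G) M (fun i j hij c hc ↦ ?_) h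
      fun A B hA hB ↦ mul_mem hA hB
  rw [diag2n_eq_transvection_prod]
  exact mul_mem (mul_mem (mul_mem (mul_mem (mul_mem (h _ _ _ _) (h _ _ _ _)) (h _ _ _ _))
    (h _ _ _ _)) (h _ _ _ _)) (h _ _ _ _)

end Elementary

section Cyclic

variable {F : Type*} [Field F] {n : ℕ}

/-- The elementary transvection with entry `x` at position `(i, j)` is defined and lies in `G`. -/
def HasTransvection (G : Subgroup (SpecialLinearGroup (Fin n) F)) (i j : Fin n) (x : F) : Prop :=
  ∃ hij : i ≠ j, transvection hij x ∈ G

theorem HasTransvection.mul {G : Subgroup (SpecialLinearGroup (Fin n) F)} {i j k : Fin n} {x y : F}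
    (h₁ : HasTransvection G i j x) (h₂ : HasTransvection G j k y) (hik : i ≠ k) :
    HasTransvection G i k (x * y) := by
  obtain ⟨hij, h₁⟩ := h₁
  obtain ⟨hjk, h₂⟩ := h₂
  refine ⟨hik, ?_⟩
  rw [← transvection_commutator hij hjk hik]
  exact mul_mem (mul_mem (mul_mem h₁ h₂) (inv_mem h₁)) (inv_mem h₂)

theorem hasTransvection_pow {G : Subgroup (SpecialLinearGroup (Fin n) F)} (hn : 3 ≤ n) {a : F}
    (h₁ : ∀ i j : Fin n, i.val + 1 = j.val → HasTransvection G i j 1)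
    (h₂ : ∀ i j : Fin n, i.val + 1 = n → j.val = 0 → HasTransvection G i j a) (k : ℕ) :
    (∀ i j : Fin n, i < j → HasTransvection G i j (a ^ k)) ∧
      ∀ i j : Fin n, j < i → HasTransvection G i j (a ^ (k + 1)) := by
  have up : ∀ (d : ℕ) (i j : Fin n), i.val + d + 1 = j.val → HasTransvection G i j 1 := by
    intro d
    induction d with
    | zero => exact h₁
    | succ d ih =>
      intro i j hij
      have := (ih i ⟨i.val + d + 1, by omega⟩ rfl).mul (h₁ _ j (by simp; omega))
        (by rw [Ne, Fin.ext_iff]; omega)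
      simpa using this
  replace up (i j : Fin n) (hij : i < j) : HasTransvection G i j 1 :=
    up (j.val - i.val - 1) i j (by rw [Fin.lt_def] at hij; omega)
  let z : Fin n := ⟨0, by omega⟩
  let l : Fin n := ⟨n - 1, by omega⟩
  have toZero (i : Fin n) (hi : z < i) : HasTransvection G i z a := by
    by_cases hl : i = l
    · exact h₂ _ _ (by simp [hl, l]; omega) rfl
    · simpa using (up i l (by simp only [Fin.lt_def, Fin.ext_iff, l] at *; omega)).mul
        (h₂ l z (by simp [l]; omega) rfl) hi.ne'
  have down (i j : Fin n) (hij : j < i) : HasTransvection G i j a := by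
    by_cases hj : j = z
    · exact hj ▸ toZero i (hj ▸ hij)
    · have hz : z < j := by simp only [Fin.lt_def, Fin.ext_iff, z] at *; omega
      simpa using (toZero i (hz.trans hij)).mul (up z j hz) hij.ne'
  induction k with
  | zero => simpa using ⟨up, down⟩
  | succ k ih =>
    obtain ⟨ihu, ihd⟩ := ih
    have up' (i j : Fin n) (hij : i < j) (hne : ¬ (i = z ∧ j = l)) :
        HasTransvection G i j (a ^ (k + 1)) := by
      by_cases hj : j = l
      · have hz : z < i := by
          simp only [hj, and_true, z, Fin.lt_def, Fin.ext_iff] at *; omega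
        simpa [pow_succ] using (ihd i z hz).mul (up z j (hz.trans hij)) hij.ne
      · have hl : j < l := by
          simp only [l, Fin.lt_def, Fin.ext_iff] at *; omega
        simpa [pow_succ] using (ihu i l (hij.trans hl)).mul (down l j hl) hij.ne
    have up'' (i j : Fin n) (hij : i < j) : HasTransvection G i j (a ^ (k + 1)) := by
      by_cases hne : i = z ∧ j = l
      · obtain ⟨rfl, rfl⟩ := hne
        let o : Fin n := ⟨1, by omega⟩
        have hzo : z < o := by simp [Fin.lt_def, z, o]
        have hol : o < l := by simp only [Fin.lt_def, o, l]; omega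
        simpa using (up' z o hzo fun h ↦ hol.ne h.2).mul (up o l hol) hij.ne
      · exact up' i j hij hne
    refine ⟨up'', fun i j hij ↦ ?_⟩
    obtain ⟨m, hmi, hmj⟩ : ∃ m : Fin n, m ≠ i ∧ m ≠ j := by
      have : ({i, j} : Finset (Fin n)).card < Fintype.card (Fin n) :=
        Finset.card_le_two.trans_lt (by rw [Fintype.card_fin]; exact hn)
      obtain ⟨m, hm⟩ := Finset.exists_mem_notMem_of_card_lt_card
        (s := {i, j}) (t := Finset.univ) (by simpa using this)
      exact ⟨m, by simp_all⟩
    rcases lt_or_gt_of_ne hmi with hmi | hmi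
    · rcases lt_or_gt_of_ne hmj with hmj | hmj
      · simpa [pow_succ'] using (down i m hmi).mul (up'' m j hmj) hij.ne'
      · simpa [pow_succ] using (ihd i m hmi).mul (down m j hmj) hij.ne'
    · simpa [pow_succ] using (up'' i m hmi).mul (down m j (hij.trans hmi)) hij.ne'

theorem eq_top_of_cyclic_transvections {G : Subgroup (SpecialLinearGroup (Fin n) F)} (hn : 3 ≤ n)
    {a : F} (ha0 : a ≠ 0) (ha : ∀ x : F, x ≠ 0 → ∃ k : ℕ, x = a ^ k)
    (h₁ : ∀ i j : Fin n, i.val + 1 = j.val → HasTransvection G i j 1)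
    (h₂ : ∀ i j : Fin n, i.val + 1 = n → j.val = 0 → HasTransvection G i j a) : G = ⊤ := by
  have : Nontrivial (Fin n) := Fin.nontrivial_iff_two_le.2 (by omega)
  refine subgroup_eq_top_of_transvection_mem G fun i j hij x ↦ ?_
  by_cases hx : x = 0
  · simp [hx]
  · rcases lt_or_gt_of_ne hij with h | h
    · obtain ⟨k, rfl⟩ := ha x hx
      exact ((hasTransvection_pow hn h₁ h₂ k).1 i j h).2
    · obtain ⟨k, hk⟩ := ha (x / a) (div_ne_zero hx ha0)
      obtain rfl : x = a ^ (k + 1) := by rw [pow_succ, ← hk, div_mul_cancel₀ x ha0]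
      exact ((hasTransvection_pow hn h₁ h₂ k).2 i j h).2

end Cyclic

section Rank2

variable {F : Type*} [Field F]

/-- The transvection of the plane with centre `(x, y)` and parameter `t`. -/
def planeTransvection (t x y : F) : SL(2, F) :=
  ⟨!![1 - t * x * y, t * x ^ 2; -(t * y ^ 2), 1 + t * x * y], by rw [det_fin_two_of]; ring⟩

theorem coe_planeTransvection (t x y : F) :
    (planeTransvection t x y : Matrix (Fin 2) (Fin 2) F) =
      !![1 - t * x * y, t * x ^ 2; -(t * y ^ 2), 1 + t * x * y] := rfl

theorem planeTransvection_add (s t x y : F) :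
    planeTransvection (s + t) x y = planeTransvection s x y * planeTransvection t x y := by
  ext i j
  fin_cases i <;> fin_cases j <;> simp [coe_planeTransvection] <;> ring

theorem planeTransvection_zero (x y : F) : planeTransvection 0 x y = 1 := by
  ext i j
  fin_cases i <;> fin_cases j <;> simp [coe_planeTransvection]

theorem planeTransvection_neg (t x y : F) :
    planeTransvection (-t) x y = (planeTransvection t x y)⁻¹ := by
  rw [eq_inv_iff_mul_eq_one, ← planeTransvection_add, neg_add_cancel, planeTransvection_zero]

theorem planeTransvection_smul (t c x y : F) :
    planeTransvection t (c * x) (c * y) = planeTransvection (t * c ^ 2) x y := by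
  ext i j
  fin_cases i <;> fin_cases j <;> simp [coe_planeTransvection] <;> ring

theorem planeTransvection_conj (g : SL(2, F)) (t x y : F) :
    g * planeTransvection t x y * g⁻¹ =
      planeTransvection t (g 0 0 * x + g 0 1 * y) (g 1 0 * x + g 1 1 * y) := by
  rw [mul_inv_eq_iff_eq_mul]
  have hg := g.det_coe
  rw [det_fin_two] at hg
  ext i j
  fin_cases i <;> fin_cases j <;>
    simp [coe_planeTransvection, Matrix.mul_apply, Fin.sum_univ_two]
  · linear_combination t * y * (g 0 0 * x + g 0 1 * y) * hg
  · linear_combination -t * x * (g 0 0 * x + g 0 1 * y) * hg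
  · linear_combination t * y * (g 1 0 * x + g 1 1 * y) * hg
  · linear_combination -t * x * (g 1 0 * x + g 1 1 * y) * hg

theorem transvection_zero_one_eq (h : (0 : Fin 2) ≠ 1) (x : F) :
    transvection h x = planeTransvection x 1 0 := by
  ext i j
  fin_cases i <;> fin_cases j <;> simp [coe_planeTransvection, transvection_coe]

theorem transvection_one_zero_eq (h : (1 : Fin 2) ≠ 0) (x : F) :
    transvection h x = planeTransvection (-x) 0 1 := by
  ext i j
  fin_cases i <;> fin_cases j <;> simp [coe_planeTransvection, transvection_coe]

variable {G : Subgroup SL(2, F)}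

theorem planeTransvection_mem_conj {g : SL(2, F)} (hg : g ∈ G) {t x y : F}
    (h : planeTransvection t x y ∈ G) :
    planeTransvection t (g 0 0 * x + g 0 1 * y) (g 1 0 * x + g 1 1 * y) ∈ G := by
  rw [← planeTransvection_conj]
  exact mul_mem (mul_mem hg h) (inv_mem hg)

theorem eq_top_of_axes (h₁ : ∀ t : F, planeTransvection t 1 0 ∈ G)
    (h₂ : ∀ t : F, planeTransvection t 0 1 ∈ G) : G = ⊤ := by
  refine subgroup_eq_top_of_transvection_mem G fun i j hij x ↦ ?_
  match i, j with
  | 0, 0 => exact absurd rfl hij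
  | 0, 1 => exact transvection_zero_one_eq hij x ▸ h₁ x
  | 1, 0 => exact transvection_one_zero_eq hij x ▸ h₂ (-x)
  | 1, 1 => exact absurd rfl hij

/-- If `G` contains all transvections with two given independent centres, it is everything. -/
theorem eq_top_of_independent_centres {x y x' y' : F} (hd : x * y' - x' * y ≠ 0)
    (h : ∀ t : F, planeTransvection t x y ∈ G) (h' : ∀ t : F, planeTransvection t x' y' ∈ G) :
    G = ⊤ := by
  have key (p q : F) (t : F) : planeTransvection t p q ∈ G := by
    obtain ⟨α, β, rfl, rfl⟩ : ∃ α β : F, p = α * x + β * x' ∧ q = α * y + β * y' :=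
      ⟨(p * y' - q * x') / (x * y' - x' * y), (x * q - y * p) / (x * y' - x' * y),
        by rw [div_mul_eq_mul_div, div_mul_eq_mul_div, ← add_div, eq_div_iff hd]; ring,
        by rw [div_mul_eq_mul_div, div_mul_eq_mul_div, ← add_div, eq_div_iff hd]; ring⟩
    by_cases hβ : β = 0
    · subst hβ
      simpa [planeTransvection_smul] using h (t * α ^ 2)
    · have hc : planeTransvection t (β * x') (β * y') ∈ G := by
        rw [planeTransvection_smul]; exact h' _
      obtain ⟨r, hr⟩ : ∃ r, r * (β * (x * y' - x' * y)) = α :=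
        ⟨_, div_mul_cancel₀ α (mul_ne_zero hβ hd)⟩
      convert planeTransvection_mem_conj (h r) hc using 2
      · simp [coe_planeTransvection]
        linear_combination (-x) * hr
      · simp [coe_planeTransvection]
        linear_combination (-y) * hr
  exact eq_top_of_axes (fun t ↦ key _ _ t) (fun t ↦ key _ _ t)

/-- `G` contains a nontrivial transvection with centre `(x, y)`. -/
def IsCentre (G : Subgroup SL(2, F)) (x y : F) : Prop :=
  ∃ t : F, t ≠ 0 ∧ planeTransvection t x y ∈ G

theorem isCentre_smul {c x y : F} (hc : c ≠ 0) :
    IsCentre G (c * x) (c * y) ↔ IsCentre G x y := by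
  constructor
  · rintro ⟨t, ht, h⟩
    exact ⟨t * c ^ 2, mul_ne_zero ht (pow_ne_zero 2 hc), planeTransvection_smul t c x y ▸ h⟩
  · rintro ⟨t, ht, h⟩
    refine ⟨t / c ^ 2, div_ne_zero ht (pow_ne_zero 2 hc), ?_⟩
    rwa [planeTransvection_smul, div_mul_cancel₀ t (pow_ne_zero 2 hc)]

theorem IsCentre.map {g : SL(2, F)} (hg : g ∈ G) {x y : F} (h : IsCentre G x y) :
    IsCentre G (g 0 0 * x + g 0 1 * y) (g 1 0 * x + g 1 1 * y) := by
  obtain ⟨t, ht, h⟩ := h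
  exact ⟨t, ht, planeTransvection_mem_conj hg h⟩

/-- `(x, y)` is an eigenvector of `g` with eigenvalue `c`. -/
def IsEigen (g : SL(2, F)) (c x y : F) : Prop :=
  g 0 0 * x + g 0 1 * y = c * x ∧ g 1 0 * x + g 1 1 * y = c * y

/-- Every square of a nonzero element is an even power of `c`. -/
def SquaresArePowers (c : F) : Prop := ∀ s : F, s ≠ 0 → ∃ k : ℕ, s ^ 2 = c ^ (2 * k)

theorem SquaresArePowers.inv {c : F} (h : SquaresArePowers c) : SquaresArePowers c⁻¹ := by
  intro s hs
  obtain ⟨k, hk⟩ := h s⁻¹ (inv_ne_zero hs)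
  exact ⟨k, by rw [inv_pow, ← hk, inv_pow, inv_inv]⟩

theorem planeTransvection_mem_of_eigen (h2 : (2 : F) ≠ 0) {D : SL(2, F)} (hD : D ∈ G) {c x y : F}
    (hc : SquaresArePowers c) (hE : IsEigen D c x y) (h : IsCentre G x y) (t : F) :
    planeTransvection t x y ∈ G := by
  obtain ⟨r, hr, h⟩ := h
  have hpow (k : ℕ) : planeTransvection (r * c ^ (2 * k)) x y ∈ G := by
    induction k with
    | zero => simpa using h
    | succ k ih =>
      have := planeTransvection_mem_conj hD ih
      rw [hE.1, hE.2, planeTransvection_smul] at this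
      convert this using 2
      ring
  have hsq (s : F) : planeTransvection (r * s ^ 2) x y ∈ G := by
    by_cases hs : s = 0
    · simp [hs, planeTransvection_zero]
    · obtain ⟨k, hk⟩ := hc s hs
      exact hk ▸ hpow k
  have : t = r * ((t / r + 1) / 2) ^ 2 + -(r * ((t / r - 1) / 2) ^ 2) := by
    field_simp; ring
  rw [this, planeTransvection_add, planeTransvection_neg]
  exact mul_mem (hsq _) (inv_mem (hsq _))

theorem eq_top_of_eigen (h2 : (2 : F) ≠ 0) {D : SL(2, F)} (hD : D ∈ G) {c x y : F}
    (hc : SquaresArePowers c) (hE : IsEigen D c x y) (h : IsCentre G x y)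
    (hu : planeTransvection 1 1 0 ∈ G) (hy : y ≠ 0) : G = ⊤ := by
  have hall := planeTransvection_mem_of_eigen h2 hD hc hE h
  refine eq_top_of_independent_centres ?_ hall fun t ↦ planeTransvection_mem_conj hu (hall t)
  have : -y ^ 2 ≠ 0 := neg_ne_zero.2 (pow_ne_zero 2 hy)
  convert this using 1
  simp [coe_planeTransvection]
  ring

theorem isCentre_torus {D : SL(2, F)} (hD : D ∈ G) {c x₁ y₁ x₂ y₂ α β s : F} (hc0 : c ≠ 0)
    (hc : SquaresArePowers c) (h₁ : IsEigen D c x₁ y₁) (h₂ : IsEigen D c⁻¹ x₂ y₂)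
    (h : IsCentre G (α * x₁ + β * x₂) (α * y₁ + β * y₂)) (hs : s ≠ 0) :
    IsCentre G (s ^ 2 * α * x₁ + β * x₂) (s ^ 2 * α * y₁ + β * y₂) := by
  have hpow (k : ℕ) : IsCentre G (c ^ (2 * k) * α * x₁ + β * x₂)
      (c ^ (2 * k) * α * y₁ + β * y₂) := by
    induction k with
    | zero => simpa using h
    | succ k ih =>
      have := (isCentre_smul hc0).2 (ih.map hD)
      have e₁ := h₁.1
      have e₂ := h₁.2
      have e₃ : c * (D 0 0 * x₂ + D 0 1 * y₂) = x₂ := by rw [h₂.1]; field_simp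
      have e₄ : c * (D 1 0 * x₂ + D 1 1 * y₂) = y₂ := by rw [h₂.2]; field_simp
      convert this using 1
      · linear_combination (-c * c ^ (2 * k) * α) * e₁ - β * e₃
      · linear_combination (-c * c ^ (2 * k) * α) * e₂ - β * e₄
  obtain ⟨k, hk⟩ := hc s hs
  exact hk ▸ hpow k

theorem IsCentre.of_unipotent (hu : planeTransvection 1 1 0 ∈ G) {x y : F}
    (h : IsCentre G (x + y) y) : IsCentre G x y := by
  have := h.map (inv_mem hu)
  rw [← planeTransvection_neg] at this
  simpa [planeTransvection] using this

/-- If `-1` is a square, the split torus generated by the product of the two transvections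
meets enough centres. -/
theorem eq_top_of_isSquare_neg_one (h2 : (2 : F) ≠ 0) {c a : F}
    (hgen : ∀ x : F, x ≠ 0 → ∃ k : ℕ, x = c ^ k) (hns : ¬ IsSquare c)
    (hi : IsSquare (-1 : F)) (ha : a = (c - 1) ^ 2 / c)
    (hu : planeTransvection 1 1 0 ∈ G) (hl : planeTransvection (-a) 0 1 ∈ G) : G = ⊤ := by
  have hc0 : c ≠ 0 := by rintro rfl; exact hns (IsSquare.zero)
  have hc1 : c - 1 ≠ 0 := fun h ↦ hns (sub_eq_zero.1 h ▸ IsSquare.one)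
  have hc1' : 1 - c ≠ 0 := by rwa [← neg_sub, neg_ne_zero]
  have hc2 : c + 1 ≠ 0 := fun h ↦ hns (eq_neg_of_add_eq_zero_left h ▸ hi)
  have hpow : SquaresArePowers c := fun s hs ↦ by
    obtain ⟨k, rfl⟩ := hgen s hs
    exact ⟨k, by ring⟩
  have hac : a * c = (c - 1) ^ 2 := by rw [ha, div_mul_cancel₀ _ hc0]
  have hcc : c * c⁻¹ = 1 := mul_inv_cancel₀ hc0
  have hD := mul_mem hu hl
  have h₁ : IsEigen (planeTransvection 1 1 0 * planeTransvection (-a) 0 1) c c (c - 1) := by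
    constructor
    · simp [coe_planeTransvection]
      linear_combination hac
    · simp [coe_planeTransvection]
      linear_combination hac
  have h₂ : IsEigen (planeTransvection 1 1 0 * planeTransvection (-a) 0 1) c⁻¹ 1 (1 - c) := by
    have ha' : a = c - 2 + c⁻¹ := by rw [ha]; field_simp; ring
    constructor
    · simp [coe_planeTransvection]
      linear_combination ha'
    · simp [coe_planeTransvection]
      linear_combination ha' + hcc
  have hcen (s : F) (hs : s ≠ 0) :
      IsCentre G (s ^ 2 * 1 * c + 1 * 1) (s ^ 2 * 1 * (c - 1) + 1 * (1 - c)) := by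
    refine isCentre_torus hD hc0 hpow h₁ h₂ ?_ hs
    convert (isCentre_smul hc2).2 (⟨1, one_ne_zero, hu⟩ : IsCentre G 1 0) using 1 <;> ring
  have hdich : IsSquare ((1 - c) / 2) ∨ IsSquare (c * ((1 - c) / 2)) := by
    obtain ⟨k, hk⟩ := hgen _ (div_ne_zero hc1' h2)
    rw [hk, ← pow_succ']
    rcases Nat.even_or_odd k with h | h
    · exact Or.inl (h.isSquare_pow c)
    · exact Or.inr (h.add_one.isSquare_pow c)
  rcases hdich with ⟨s, hs⟩ | ⟨s, hs⟩
  · have hs0 : s ≠ 0 := by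
      rintro rfl
      exact div_ne_zero hc1' h2 (by simpa using hs)
    have hs' : 1 - c = 2 * s ^ 2 := by rw [pow_two, ← hs, mul_div_cancel₀ _ h2]
    refine eq_top_of_eigen h2 hD hpow.inv h₂ (.of_unipotent hu ?_) hu hc1'
    rw [← isCentre_smul hc2]
    convert (isCentre_smul h2).2 (hcen s hs0) using 1
    · linear_combination c * hs'
    · linear_combination (c - 1) * hs'
  · obtain ⟨i, hi⟩ := hi
    have hs0 : s ≠ 0 := by
      rintro rfl
      exact mul_ne_zero hc0 (div_ne_zero hc1' h2) (by simpa using hs)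
    have hi0 : i ≠ 0 := by
      rintro rfl
      simp at hi
    have hs' : c * (1 - c) = 2 * s ^ 2 := by rw [pow_two, ← hs]; field_simp
    have hr : (i * c / s) ^ 2 * (c - 1) = 2 * c := by
      rw [div_pow, div_mul_eq_mul_div, div_eq_iff (pow_ne_zero 2 hs0)]
      linear_combination c * hs' - c ^ 2 * (c - 1) * hi
    refine eq_top_of_eigen h2 hD hpow h₁ (.of_unipotent hu ?_) hu hc1
    rw [← isCentre_smul hc2]
    convert (isCentre_smul hc1).2 (hcen (i * c / s) (div_ne_zero (mul_ne_zero hi0 hc0) hs0)) using 1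
    · linear_combination (-c) * hr
    · linear_combination (1 - c) * hr

/-- If `-1` is not a square, the split torus generated by the commutator of the two transvections
meets enough centres. -/
theorem eq_top_of_not_isSquare_neg_one (h2 : (2 : F) ≠ 0) {c a : F}
    (hgen : ∀ x : F, x ≠ 0 → ∃ k : ℕ, x = c ^ k) (hns : ¬ IsSquare c)
    (hi : ¬ IsSquare (-1 : F)) (hc2 : c + 1 ≠ 0) (ha : a = c - c⁻¹)
    (hu : planeTransvection 1 1 0 ∈ G) (hl : planeTransvection (-a) 0 1 ∈ G) : G = ⊤ := by
  have hc0 : c ≠ 0 := by rintro rfl; exact hns (IsSquare.zero)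
  have hc1 : c - 1 ≠ 0 := fun h ↦ hns (sub_eq_zero.1 h ▸ IsSquare.one)
  have hd : c ^ 2 + 1 ≠ 0 := fun h ↦
    hi ⟨c, by rw [← pow_two]; exact (eq_neg_of_add_eq_zero_left h).symm⟩
  have hdich (x : F) (hx : x ≠ 0) : IsSquare x ∨ IsSquare (-x) := by
    obtain ⟨m, hm⟩ := hgen (-1) (neg_ne_zero.2 one_ne_zero)
    have hmo : Odd m := Nat.not_even_iff_odd.1 fun h ↦ hi (hm ▸ h.isSquare_pow c)
    obtain ⟨k, rfl⟩ := hgen x hx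
    rcases Nat.even_or_odd k with h | h
    · exact Or.inl (h.isSquare_pow c)
    · right
      rw [← neg_one_mul, hm, ← pow_add]
      exact (hmo.add_odd h).isSquare_pow c
  have hpow : SquaresArePowers (c ^ 2) := fun s hs ↦ by
    obtain ⟨w, hw⟩ : ∃ w : F, s ^ 2 = w ^ 4 := by
      rcases hdich s hs with ⟨w, hw⟩ | ⟨w, hw⟩
      · exact ⟨w, by rw [hw]; ring⟩
      · exact ⟨w, by rw [← neg_sq, hw]; ring⟩
    have hw0 : w ≠ 0 := by
      rintro rfl
      exact pow_ne_zero 2 hs (by simpa using hw)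
    obtain ⟨k, rfl⟩ := hgen w hw0
    exact ⟨k, by rw [hw]; ring⟩
  have hac : a * c = c ^ 2 - 1 := by rw [ha]; field_simp
  have hcc : c * c⁻¹ = 1 := mul_inv_cancel₀ hc0
  have hD := mul_mem (mul_mem (mul_mem hu hl) (inv_mem hu)) (inv_mem hl)
  simp only [← planeTransvection_neg] at hD
  set D : SL(2, F) := planeTransvection 1 1 0 * planeTransvection (-a) 0 1 *
    planeTransvection (-1) 1 0 * planeTransvection (- -a) 0 1 with hDdef
  have hDval : (D : Matrix (Fin 2) (Fin 2) F) = !![1 + a + a ^ 2, -a; a ^ 2, 1 - a] := by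
    ext i j
    fin_cases i <;> fin_cases j <;> simp [hDdef, coe_planeTransvection] <;> ring
  have h₁ : IsEigen D (c ^ 2) c (c - 1) := by
    constructor <;> simp [hDval, ha] <;> field_simp <;> ring
  have h₂ : IsEigen D (c ^ 2)⁻¹ 1 (c + 1) := by
    constructor <;> simp [hDval, ha] <;> field_simp <;> ring
  have hcen (s : F) (hs : s ≠ 0) :
      IsCentre G (s ^ 2 * 1 * c + (-c) * 1) (s ^ 2 * 1 * (c - 1) + (-c) * (c + 1)) := by
    refine isCentre_torus hD (pow_ne_zero 2 hc0) hpow h₁ h₂ ?_ hs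
    have ha0 : -a ≠ 0 := by
      rw [neg_ne_zero]
      rintro rfl
      exact mul_ne_zero hc1 hc2 (by linear_combination -hac)
    convert (isCentre_smul (neg_ne_zero.2 hd)).2 (⟨-a, ha0, hl⟩ : IsCentre G 0 1) using 1 <;> ring
  rcases hdich (2 * c) (mul_ne_zero h2 hc0) with ⟨w, hw⟩ | ⟨w, hw⟩
  · have hw0 : w ≠ 0 := by
      rintro rfl
      exact mul_ne_zero h2 hc0 (by simpa using hw)
    have hr : (w * c / (c - 1)) ^ 2 * (c - 1) ^ 2 = 2 * c ^ 3 := by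
      rw [← mul_pow, div_mul_cancel₀ _ hc1]
      linear_combination (-c ^ 2) * hw
    refine eq_top_of_eigen h2 hD hpow h₁ (.of_unipotent hu ?_) hu hc1
    rw [← isCentre_smul (mul_ne_zero hd hc0)]
    convert (isCentre_smul (pow_ne_zero 2 hc1)).2
      (hcen (w * c / (c - 1)) (div_ne_zero (mul_ne_zero hw0 hc0) hc1)) using 1
    · linear_combination (-c) * hr
    · linear_combination (1 - c) * hr
  · have hw0 : w ≠ 0 := by
      rintro rfl
      exact mul_ne_zero h2 hc0 (by simpa using hw)
    have hr : 2 * (w * (c + 1) / 2) ^ 2 = -c * (c + 1) ^ 2 := by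
      rw [div_pow, mul_div_assoc', div_eq_iff (pow_ne_zero 2 h2)]
      linear_combination (-2 * (c + 1) ^ 2) * hw
    refine eq_top_of_eigen h2 hD hpow.inv h₂ (.of_unipotent hu ?_) hu hc2
    rw [← isCentre_smul (mul_ne_zero hd (neg_ne_zero.2 hc0))]
    convert (isCentre_smul h2).2
      (hcen (w * (c + 1) / 2) (div_ne_zero (mul_ne_zero hw0 hc2) h2)) using 1
    · linear_combination (-c) * hr
    · linear_combination (1 - c) * hr

theorem eq_top_of_mem_of_forall_eq (hF : ∀ x : F, x = 0 ∨ x = 1 ∨ x = -1)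
    (hu : planeTransvection 1 1 0 ∈ G) (hl : planeTransvection (-1) 0 1 ∈ G) : G = ⊤ := by
  refine eq_top_of_axes (fun t ↦ ?_) (fun t ↦ ?_) <;> rcases hF t with rfl | rfl | rfl
  · exact planeTransvection_zero (F := F) 1 0 ▸ one_mem G
  · exact hu
  · exact planeTransvection_neg (1 : F) 1 0 ▸ inv_mem hu
  · exact planeTransvection_zero (F := F) 0 1 ▸ one_mem G
  · rw [← inv_mem_iff, ← planeTransvection_neg]
    exact hl
  · exact hl

end Rank2

section Generators

variable {F : Type*} [Field F]

theorem exists_forall_eq_pow [Finite F] :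
    ∃ c : F, c ≠ 0 ∧ ∀ x : F, x ≠ 0 → ∃ k : ℕ, x = c ^ k := by
  obtain ⟨c, hc⟩ := IsCyclic.exists_monoid_generator (α := Fˣ)
  refine ⟨c, c.ne_zero, fun x hx ↦ ?_⟩
  obtain ⟨k, hk⟩ := hc (Units.mk0 x hx)
  exact ⟨k, by simpa using congrArg Units.val hk.symm⟩

theorem exists_rank_two_parameter [Fintype F] (h : ¬ (ringChar F = 2 ∧ 4 ≤ Fintype.card F)) :
    ∃ a : F, a ≠ 0 ∧ ∀ G : Subgroup SL(2, F), planeTransvection 1 1 0 ∈ G →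
      planeTransvection (-a) 0 1 ∈ G → G = ⊤ := by
  classical
  obtain ⟨c, hc0, hgen⟩ := exists_forall_eq_pow (F := F)
  by_cases hF : ∀ x : F, x = 0 ∨ x = 1 ∨ x = -1
  · exact ⟨1, one_ne_zero, fun G ↦ eq_top_of_mem_of_forall_eq hF⟩
  have hchar : ringChar F ≠ 2 := by
    intro hchar
    have heven := FiniteField.even_card_of_char_two hchar
    have hcard : Fintype.card F ≤ 2 := by
      by_contra hlt
      exact h ⟨hchar, by omega⟩
    refine hF fun x ↦ ?_
    by_contra hx
    push Not at hx
    have : ({0, 1, x} : Finset F).card ≤ Fintype.card F := Finset.card_le_univ _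
    rw [Finset.card_eq_three.2 ⟨0, 1, x, zero_ne_one, hx.1.symm, hx.2.1.symm, rfl⟩] at this
    omega
  have h2 : (2 : F) ≠ 0 := Ring.two_ne_zero hchar
  have hns : ¬ IsSquare c := by
    intro hsq
    obtain ⟨b, hb⟩ := FiniteField.exists_nonsquare hchar
    by_cases hb0 : b = 0
    · exact hb (hb0 ▸ IsSquare.zero)
    · obtain ⟨k, rfl⟩ := hgen b hb0
      exact hb (hsq.pow k)
  have hc1 : c - 1 ≠ 0 := fun h ↦ hns (sub_eq_zero.1 h ▸ IsSquare.one)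
  by_cases hi : IsSquare (-1 : F)
  · exact ⟨(c - 1) ^ 2 / c, div_ne_zero (pow_ne_zero 2 hc1) hc0, fun G ↦
      eq_top_of_isSquare_neg_one h2 hgen hns hi rfl⟩
  · have hc2 : c + 1 ≠ 0 := by
      intro hc2
      obtain rfl := eq_neg_of_add_eq_zero_left hc2
      refine hF fun x ↦ or_iff_not_imp_left.2 fun hx ↦ ?_
      obtain ⟨k, rfl⟩ := hgen x hx
      exact neg_one_pow_eq_or F k
    refine ⟨c - c⁻¹, fun h ↦ mul_ne_zero hc1 hc2 ?_, fun G ↦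
      eq_top_of_not_isSquare_neg_one h2 hgen hns hi hc2 rfl⟩
    have hcc : c * c⁻¹ = 1 := mul_inv_cancel₀ hc0
    linear_combination c * h + hcc

/-- The elementary transvections along a directed `n`-cycle, with all parameters `1` except the
last one, which is `a`. -/
theorem exists_finset_of_cycle {n : ℕ} (hn : 2 ≤ n) {a : F} (ha : a ≠ 0)
    (h : ∀ G : Subgroup (SpecialLinearGroup (Fin n) F),
      (∀ i j : Fin n, i.val + 1 = j.val → HasTransvection G i j 1) →
      (∀ i j : Fin n, i.val + 1 = n → j.val = 0 → HasTransvection G i j a) → G = ⊤) :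
    ∃ S : Finset (SpecialLinearGroup (Fin n) F), S.card = n ∧
      (∀ A ∈ S, Matrix.IsLinearInstruction (A : Matrix (Fin n) (Fin n) F)) ∧
      Subgroup.closure (S : Set (SpecialLinearGroup (Fin n) F)) = ⊤ := by
  classical
  let next (i : Fin n) : Fin n := ⟨if i.val + 1 = n then 0 else i.val + 1, by split <;> omega⟩
  have hnext (i : Fin n) : i ≠ next i := by
    rw [Ne, Fin.ext_iff]
    simp only [next]
    split <;> omega
  let g (i : Fin n) : SpecialLinearGroup (Fin n) F :=
    transvection (hnext i) (if i.val + 1 = n then a else 1)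
  have hg (i : Fin n) : ((g i : Matrix (Fin n) (Fin n) F)) =
      1 + single i (next i) (if i.val + 1 = n then a else 1) := rfl
  have hrow (i j : Fin n) (hj : j ≠ i) : (g i).1 j = (1 : Matrix (Fin n) (Fin n) F) j := by
    ext k
    rw [hg]
    simp [hj.symm]
  have hinj : Function.Injective g := by
    intro i j hij
    by_contra hne
    have := congrFun (hrow j i hne) (next i)
    rw [← hij, hg] at this
    simp [one_apply_ne (hnext i)] at this
    split at this <;> simp_all
  refine ⟨Finset.univ.image g, ?_, ?_, h _ (fun i j hij ↦ ?_) (fun i j hi hj ↦ ?_)⟩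
  · rw [Finset.card_image_of_injective _ hinj, Finset.card_univ, Fintype.card_fin]
  · intro A hA
    obtain ⟨i, -, rfl⟩ := Finset.mem_image.1 hA
    exact ⟨i, hrow i⟩
  · have hni : i.val + 1 ≠ n := by have := j.isLt; omega
    obtain rfl : j = next i := by ext; simp only [next, if_neg hni]; exact hij.symm
    refine ⟨hnext i, ?_⟩
    have : g i = transvection (hnext i) 1 := by simp only [g, if_neg hni]
    rw [← this]
    exact Subgroup.subset_closure (by simp)
  · obtain rfl : j = next i := by ext; simp only [next, if_pos hi]; exact hj
    refine ⟨hnext i, ?_⟩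
    have : g i = transvection (hnext i) a := by simp only [g, if_pos hi]
    rw [← this]
    exact Subgroup.subset_closure (by simp)

end Generators

end Matrix.SpecialLinearGroup

open Matrix.SpecialLinearGroup in
/-- Except when `n = 2`, `char F = 2` and `|F| ≥ 4`, the group `SL(n, F)` is generated
by a set of `n` linear instructions of determinant `1`. -/
theorem SL_generated_by_n_instructions
    (F : Type*) [Field F] [Fintype F] (n : ℕ) (hn : 2 ≤ n)
    (h : ¬ (n = 2 ∧ ringChar F = 2 ∧ 4 ≤ Fintype.card F)) :
    ∃ S : Finset (Matrix.SpecialLinearGroup (Fin n) F),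
      S.card = n ∧
      (∀ A ∈ S, Matrix.IsLinearInstruction (A : Matrix (Fin n) (Fin n) F)) ∧
      Subgroup.closure (S : Set (Matrix.SpecialLinearGroup (Fin n) F)) = ⊤ := by
  rcases hn.eq_or_lt with rfl | hn3
  · obtain ⟨a, ha, hG⟩ := exists_rank_two_parameter (F := F) (fun h' ↦ h ⟨rfl, h'⟩)
    refine exists_finset_of_cycle le_rfl ha fun G h₁ h₂ ↦ hG G ?_ ?_
    · obtain ⟨hij, hm⟩ := h₁ 0 1 rfl
      rwa [transvection_zero_one_eq] at hm
    · obtain ⟨hij, hm⟩ := h₂ 1 0 rfl rfl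
      rwa [transvection_one_zero_eq] at hm
  · obtain ⟨a, ha, hgen⟩ := exists_forall_eq_pow (F := F)
    exact exists_finset_of_cycle hn ha fun G ↦ eq_top_of_cyclic_transvections hn3 ha hgen
end

section
/- Let F be a finite field of characteristic 2 with |F| = 2^m ≥ 4. Then no set of two matrices over F, each of determinant 1 and each differing from the 2×2 identity matrix in at most one row, generates the special linear group SL(2,F). -/
open Matrix

/-- In a group generated by two involutions `a` and `b` (a dihedral group), every element `g`
satisfies `g ∈ ⟨ab⟩` or `a * g ∈ ⟨ab⟩`. -/
theorem mem_zpowers_or_mul_mem_zpowers_of_mem_closure_pair {G : Type*} [Group G] {a b g : G}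
    (ha : a * a = 1) (hb : b * b = 1) (hg : g ∈ Subgroup.closure ({a, b} : Set G)) :
    g ∈ Subgroup.zpowers (a * b) ∨ a * g ∈ Subgroup.zpowers (a * b) := by
  have hu : a * b ∈ Subgroup.zpowers (a * b) := Subgroup.mem_zpowers _
  have ha' : a⁻¹ = a := inv_eq_of_mul_eq_one_left ha
  have hb' : b⁻¹ = b := inv_eq_of_mul_eq_one_left hb
  have step : ∀ x ∈ ({a, b} : Set G), ∀ y : G,
      y ∈ Subgroup.zpowers (a * b) ∨ a * y ∈ Subgroup.zpowers (a * b) →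
      x * y ∈ Subgroup.zpowers (a * b) ∨ a * (x * y) ∈ Subgroup.zpowers (a * b) := by
    rintro x (rfl | rfl) y (hy | hy)
    · right
      rwa [← mul_assoc, ha, one_mul]
    · exact .inl hy
    · right
      rw [← mul_assoc]
      exact mul_mem hu hy
    · left
      have h := mul_mem (inv_mem hu) hy
      rwa [_root_.mul_inv_rev, hb', mul_assoc, inv_mul_cancel_left] at h
  induction hg using Subgroup.closure_induction_left with
  | one => exact .inl (one_mem _)
  | mul_left x hx y _ ih => exact step x hx y ih
  | inv_mul_cancel x hx y _ ih =>
    have hx' : x⁻¹ = x := by rcases hx with rfl | rfl <;> assumption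
    rw [hx']
    exact step x hx y ih

/-- In a group generated by two involutions, every square lies in the rotation subgroup. -/
theorem mul_self_mem_zpowers_of_mem_closure_pair {G : Type*} [Group G] {a b g : G}
    (ha : a * a = 1) (hb : b * b = 1) (hg : g ∈ Subgroup.closure ({a, b} : Set G)) :
    g * g ∈ Subgroup.zpowers (a * b) := by
  have ha' : a⁻¹ = a := inv_eq_of_mul_eq_one_left ha
  have hb' : b⁻¹ = b := inv_eq_of_mul_eq_one_left hb
  obtain h | ⟨k, hk⟩ := mem_zpowers_or_mul_mem_zpowers_of_mem_closure_pair ha hb hg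
  · exact mul_mem h h
  · have hk : (a * b) ^ k = a * g := hk
    have hconj : a * (a * b) * a⁻¹ = (a * b)⁻¹ := by
      rw [← mul_assoc, ha, one_mul, _root_.mul_inv_rev, hb']
    have h : a * (a * b) ^ k * a⁻¹ = ((a * b) ^ k)⁻¹ := by
      rw [← conj_zpow, hconj, _root_.inv_zpow]
    rw [hk, ← mul_assoc, ha, one_mul, _root_.mul_inv_rev, mul_left_inj] at h
    have hgg : g * g = 1 := mul_eq_one_iff_eq_inv.mpr h
    exact hgg ▸ one_mem _

/-- Squares commute in a group generated by two involutions. -/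
theorem commute_mul_self_of_closure_pair_eq_top {G : Type*} [Group G] {a b : G}
    (ha : a * a = 1) (hb : b * b = 1) (h : Subgroup.closure ({a, b} : Set G) = ⊤) (x y : G) :
    Commute (x * x) (y * y) := by
  have hmem : ∀ g : G, g * g ∈ Subgroup.zpowers (a * b) := fun g =>
    mul_self_mem_zpowers_of_mem_closure_pair ha hb (h ▸ Subgroup.mem_top g)
  obtain ⟨k, hk⟩ := hmem x
  obtain ⟨l, hl⟩ := hmem y
  rw [← hk, ← hl]
  exact (Commute.refl (a * b)).zpow_zpow k l

/-- Linear instructions in `SL(2, F)` are involutions in characteristic `2`. -/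
theorem Matrix.IsLinearInstruction.mul_self_eq_one {F : Type*} [Field F] [CharP F 2]
    {A : Matrix.SpecialLinearGroup (Fin 2) F}
    (hA : Matrix.IsLinearInstruction (A : Matrix (Fin 2) (Fin 2) F)) : A * A = 1 := by
  have hdet := A.det_coe
  rw [Matrix.det_fin_two] at hdet
  obtain ⟨i, hi⟩ := hA
  ext r s
  rw [Matrix.SpecialLinearGroup.coe_mul, Matrix.mul_apply, Fin.sum_univ_two]
  fin_cases i
  · have h0 := congrFun (hi 1 (by simp)) 0
    have h1 := congrFun (hi 1 (by simp)) 1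
    simp only [Matrix.one_apply_eq, Matrix.one_apply_ne one_ne_zero] at h0 h1
    simp only [h0, h1, mul_one, mul_zero, sub_zero] at hdet
    fin_cases r <;> fin_cases s <;> simp [h0, h1, hdet, CharTwo.add_self_eq_zero]
  · have h0 := congrFun (hi 0 (by simp)) 0
    have h1 := congrFun (hi 0 (by simp)) 1
    simp only [Matrix.one_apply_eq, Matrix.one_apply_ne zero_ne_one] at h0 h1
    simp only [h0, h1, one_mul, zero_mul, sub_zero] at hdet
    fin_cases r <;> fin_cases s <;> simp [h0, h1, hdet, CharTwo.add_self_eq_zero]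

/-- If `F` has an element other than `0` and `1`, then `SL(2, F)` in characteristic `2` contains
two elements whose squares do not commute. -/
theorem Matrix.SpecialLinearGroup.exists_not_commute_mul_self {F : Type*} [Field F] [CharP F 2]
    {t : F} (h0 : t ≠ 0) (h1 : t ≠ 1) :
    ∃ x y : Matrix.SpecialLinearGroup (Fin 2) F, ¬ Commute (x * x) (y * y) := by
  have hdet : ∀ c : F, (!![t, c; 0, t⁻¹]).det = 1 := fun c => by
    simp [Matrix.det_fin_two_of, h0]
  refine ⟨⟨_, hdet 0⟩, ⟨_, hdet 1⟩, fun h => ?_⟩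
  have h : (!![t, 0; 0, t⁻¹] * !![t, 0; 0, t⁻¹]) * (!![t, 1; 0, t⁻¹] * !![t, 1; 0, t⁻¹]) =
      (!![t, 1; 0, t⁻¹] * !![t, 1; 0, t⁻¹]) * (!![t, 0; 0, t⁻¹] * !![t, 0; 0, t⁻¹]) :=
    congrArg Subtype.val h.eq
  replace h := congrFun₂ h 0 1
  simp only [Matrix.mul_apply, Fin.sum_univ_two, Matrix.of_apply, Matrix.cons_val_zero,
    Matrix.cons_val_one, mul_zero, zero_mul, add_zero, zero_add, mul_one, one_mul] at h
  have htwo : (2 : F) = 0 := CharTwo.two_eq_zero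
  have hpow : (t - 1) ^ 6 = 0 := by
    field_simp at h
    linear_combination h + htwo *
      (-3 * t ^ 5 + 7 * t ^ 4 - 10 * t ^ 3 + 8 * t ^ 2 - 3 * t + 1)
  exact h1 (sub_eq_zero.mp (pow_eq_zero_iff (by norm_num) |>.mp hpow))

/-- If `F` has characteristic `2` and `|F| ≥ 4`, then no two linear instructions of
determinant `1` generate `SL(2, F)`. -/
theorem SL2_char2_not_generated_by_two_instructions
    (F : Type*) [Field F] [Fintype F]
    (hchar : ringChar F = 2) (hcard : 4 ≤ Fintype.card F)
    (A B : Matrix.SpecialLinearGroup (Fin 2) F)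
    (hA : Matrix.IsLinearInstruction (A : Matrix (Fin 2) (Fin 2) F))
    (hB : Matrix.IsLinearInstruction (B : Matrix (Fin 2) (Fin 2) F)) :
    Subgroup.closure ({A, B} : Set (Matrix.SpecialLinearGroup (Fin 2) F)) ≠ ⊤ := by
  intro htop
  have : CharP F 2 := ringChar.of_eq hchar
  obtain ⟨t, h0, h1⟩ : ∃ t : F, t ≠ 0 ∧ t ≠ 1 := by
    classical
    obtain ⟨t, ht⟩ := Finset.exists_mem_notMem_of_card_lt_card
      (s := ({0, 1} : Finset F)) (t := Finset.univ)
      (lt_of_le_of_lt Finset.card_le_two (by rw [Finset.card_univ]; omega))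
    exact ⟨t, by simpa using ht⟩
  obtain ⟨x, y, hxy⟩ := Matrix.SpecialLinearGroup.exists_not_commute_mul_self h0 h1
  exact hxy (commute_mul_self_of_closure_pair_eq_top hA.mul_self_eq_one hB.mul_self_eq_one htop x y)
end

section
/- Let F be a finite field of odd cardinality. Then there exist x, y ∈ F such that the two shear matrices [[1,x],[0,1]] and [[1,0],[y,1]] generate the special linear group SL(2,F). -/
open Matrix

namespace SLTwo

variable {F : Type*} [Field F]

/-- The transvection `w ↦ w + z * det (v, w) • v` along the vector `v = (a, b)`. -/
def transvection (a b z : F) : SpecialLinearGroup (Fin 2) F :=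
  ⟨!![1 - z * a * b, z * a ^ 2; -(z * b ^ 2), 1 + z * a * b], by
    rw [det_fin_two_of]; ring⟩

@[simp] theorem transvection_zero_zero (a b z : F) : transvection a b z 0 0 = 1 - z * a * b := rfl

@[simp] theorem transvection_zero_one (a b z : F) : transvection a b z 0 1 = z * a ^ 2 := rfl

@[simp] theorem transvection_one_zero (a b z : F) : transvection a b z 1 0 = -(z * b ^ 2) := rfl

@[simp] theorem transvection_one_one (a b z : F) : transvection a b z 1 1 = 1 + z * a * b := rfl

theorem mul_apply_eq (M N : SpecialLinearGroup (Fin 2) F) (i j : Fin 2) :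
    (M * N) i j = M i 0 * N 0 j + M i 1 * N 1 j := by
  simp [Matrix.mul_apply, Fin.sum_univ_two]

theorem transvection_add (a b z w : F) :
    transvection a b (z + w) = transvection a b z * transvection a b w := by
  ext i j
  fin_cases i <;> fin_cases j <;>
    simp [mul_apply_eq] <;> ring

theorem transvection_zero (a b : F) : transvection a b 0 = 1 := by
  ext i j
  fin_cases i <;> fin_cases j <;> simp

theorem transvection_neg (a b z : F) : transvection a b (-z) = (transvection a b z)⁻¹ := by
  rw [eq_inv_iff_mul_eq_one, ← transvection_add, neg_add_cancel, transvection_zero]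

theorem transvection_smul (c a b z : F) :
    transvection (c * a) (c * b) z = transvection a b (c ^ 2 * z) := by
  ext i j
  fin_cases i <;> fin_cases j <;> simp <;> ring

theorem mul_transvection_mul_inv (M : SpecialLinearGroup (Fin 2) F) (a b z : F) :
    M * transvection a b z * M⁻¹ =
      transvection (M 0 0 * a + M 0 1 * b) (M 1 0 * a + M 1 1 * b) z := by
  rw [mul_inv_eq_iff_eq_mul]
  have hdet := M.det_coe
  rw [det_fin_two] at hdet
  ext i j
  fin_cases i <;> fin_cases j <;>
    simp [mul_apply_eq] <;> grind

theorem transvection_conj_mem {H : Subgroup (SpecialLinearGroup (Fin 2) F)}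
    {M : SpecialLinearGroup (Fin 2) F} (hM : M ∈ H) {a b z : F}
    (h : transvection a b z ∈ H) {a' b' : F} (ha : M 0 0 * a + M 0 1 * b = a')
    (hb : M 1 0 * a + M 1 1 * b = b') : transvection a' b' z ∈ H := by
  rw [← ha, ← hb, ← mul_transvection_mul_inv]
  exact H.mul_mem (H.mul_mem hM h) (H.inv_mem hM)

/-- A subgroup containing both full root subgroups of `SL(2, F)` is everything. -/
theorem eq_top_of_root_subgroups {H : Subgroup (SpecialLinearGroup (Fin 2) F)}
    (hu : ∀ z, transvection 1 0 z ∈ H) (hl : ∀ z, transvection 0 1 z ∈ H) : H = ⊤ := by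
  have key : ∀ M : SpecialLinearGroup (Fin 2) F, M 1 0 ≠ 0 → M ∈ H := by
    intro M hc
    have hM : M = transvection 1 0 ((M 0 0 - 1) / M 1 0) * transvection 0 1 (-M 1 0) *
        transvection 1 0 ((M 1 1 - 1) / M 1 0) := by
      have hdet := M.det_coe
      rw [det_fin_two] at hdet
      ext i j
      fin_cases i <;> fin_cases j <;>
        simp [mul_apply_eq] <;> grind
    rw [hM]
    exact H.mul_mem (H.mul_mem (hu _) (hl _)) (hu _)
  rw [eq_top_iff]
  intro M _
  by_cases hc : M 1 0 = 0
  · have hdet := M.det_coe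
    rw [det_fin_two, hc, mul_zero, sub_zero] at hdet
    have ha : M 0 0 ≠ 0 := left_ne_zero_of_mul_eq_one hdet
    refine (H.mul_mem_cancel_left (hl 1)).1 (key _ ?_)
    simpa [mul_apply_eq, hc] using ha
  · exact key M hc

/-- If a subgroup contains all transvections along two independent vectors, it contains
all transvections. -/
theorem transvection_mem_of_independent {H : Subgroup (SpecialLinearGroup (Fin 2) F)}
    {a b c d : F} (hdet : a * d - b * c ≠ 0) (hv : ∀ z, transvection a b z ∈ H)
    (hw : ∀ z, transvection c d z ∈ H) (x y z : F) : transvection x y z ∈ H := by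
  set α := (x * d - y * c) / (a * d - b * c) with hα
  set β := (a * y - b * x) / (a * d - b * c) with hβ
  have hx : x = α * a + β * c := by rw [hα, hβ]; grind
  have hy : y = α * b + β * d := by rw [hα, hβ]; grind
  clear_value α β
  subst hx hy
  by_cases h0 : α = 0
  · simp only [h0, zero_mul, zero_add, transvection_smul]
    exact hw _
  · have hx : α * a + β * c = α * (a + β / α * c) := by field_simp
    have hy : α * b + β * d = α * (b + β / α * d) := by field_simp
    rw [hx, hy, transvection_smul]
    refine transvection_conj_mem (hw (-(β / α) / (a * d - b * c))) (hv _) ?_ ?_ <;>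
      simp <;> field_simp <;> ring

/-- If `H` contains a nontrivial transvection along an eigenvector of an element of `H` whose
eigenvalue has powers covering `F` up to sign, then `H` contains all transvections along it. -/
theorem transvection_mem_of_eigenvector {H : Subgroup (SpecialLinearGroup (Fin 2) F)}
    (h2 : (2 : F) ≠ 0) {M : SpecialLinearGroup (Fin 2) F} (hM : M ∈ H) {a b c x : F}
    (ha : M 0 0 * a + M 0 1 * b = -c * a) (hb : M 1 0 * a + M 1 1 * b = -c * b)
    (hc : ∀ s : F, s ≠ 0 → ∃ n : ℕ, c ^ n = s) (hx : x ≠ 0)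
    (h : transvection a b x ∈ H) (z : F) : transvection a b z ∈ H := by
  have hpow : ∀ n : ℕ, transvection a b ((c ^ n) ^ 2 * x) ∈ H := by
    intro n
    induction n with
    | zero => simpa using h
    | succ n ih =>
      have h' := transvection_conj_mem hM ih ha hb
      rw [transvection_smul] at h'
      convert h' using 2
      ring
  have hsq : ∀ s : F, transvection a b (s ^ 2 * x) ∈ H := by
    intro s
    by_cases hs : s = 0
    · simp [hs, transvection_zero, H.one_mem]
    · obtain ⟨n, rfl⟩ := hc s hs
      exact hpow n
  have hz : z = ((z / x + 1) / 2) ^ 2 * x + -(((z / x - 1) / 2) ^ 2 * x) := by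
    field_simp
    ring
  rw [hz, transvection_add, transvection_neg]
  exact H.mul_mem (hsq _) (H.inv_mem (hsq _))

/-- If `g` generates `Fˣ` and `g ≠ ±1`, the two shears with `x = 1` and
`y = -(g + 1) ^ 2 / g` generate `SL(2, F)`. -/
theorem eq_top_of_generator {H : Subgroup (SpecialLinearGroup (Fin 2) F)} (h2 : (2 : F) ≠ 0)
    {g : F} (hg0 : g ≠ 0) (hg1 : g - 1 ≠ 0) (hg1' : g + 1 ≠ 0)
    (hg : ∀ s : F, s ≠ 0 → ∃ n : ℕ, g ^ n = s)
    (hA : transvection 1 0 1 ∈ H) (hB : transvection 0 1 ((g + 1) ^ 2 / g) ∈ H) : H = ⊤ := by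
  set T := transvection 1 0 1 * transvection 0 1 ((g + 1) ^ 2 / g) with hT
  have hTH : T ∈ H := H.mul_mem hA hB
  have T00 : T 0 0 = 1 - (g + 1) ^ 2 / g := by
    simp [hT, mul_apply_eq]; ring
  have T01 : T 0 1 = 1 := by
    simp [hT, mul_apply_eq]
  have T10 : T 1 0 = -((g + 1) ^ 2 / g) := by
    simp [hT, mul_apply_eq]
  have T11 : T 1 1 = 1 := by
    simp [hT, mul_apply_eq]
  -- `(g, g + 1)` and `(1, g + 1)` are eigenvectors of `T`, for `-g` and `-g⁻¹`
  let P : F → Prop := fun s =>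
    ∃ z : F, z ≠ 0 ∧ transvection (s * g - 1) ((s - 1) * (g + 1)) z ∈ H
  have step : ∀ s, P s → P (g ^ 2 * s) := by
    rintro s ⟨z, hz, h⟩
    refine ⟨(-g⁻¹) ^ 2 * z, by simp [hg0, hz], ?_⟩
    rw [← transvection_smul]
    refine transvection_conj_mem hTH h ?_ ?_
    · rw [T00, T01]; field_simp; ring
    · rw [T10, T11]; field_simp; ring
  have h_one : P 1 := by
    refine ⟨((g - 1)⁻¹) ^ 2 * 1, by simp [hg1], ?_⟩
    rw [← transvection_smul]
    convert hA using 1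
    congr 1 <;> simp [hg1]
  have h_inv : P g⁻¹ := by
    refine ⟨(-(g / ((g - 1) * (g + 1)))) ^ 2 * ((g + 1) ^ 2 / g), by simp [hg0, hg1, hg1'], ?_⟩
    rw [← transvection_smul]
    convert hB using 1
    congr 1
    · simp [hg0]
    · field_simp
      ring
  have h_pow : ∀ n : ℕ, P (g ^ n) := by
    intro n
    induction n using Nat.twoStepInduction with
    | zero => simpa using h_one
    | one =>
      convert step _ h_inv using 1
      field_simp
    | more n ih _ =>
      convert step _ ih using 1
      ring
  obtain ⟨n, hn⟩ := hg ((g + 1) / (2 * g)) (by simp [hg0, hg1', h2])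
  obtain ⟨z, hz, h⟩ := h_pow n
  have hc : (1 - g) / (2 * g) ≠ 0 := by
    rw [← neg_sub]
    exact div_ne_zero (neg_ne_zero.2 hg1) (mul_ne_zero h2 hg0)
  have hv : transvection 1 (g + 1) (((1 - g) / (2 * g)) ^ 2 * z) ∈ H := by
    rw [hn] at h
    rw [← transvection_smul]
    refine transvection_conj_mem hA h ?_ ?_ <;> simp only [transvection_zero_zero,
      transvection_zero_one, transvection_one_zero, transvection_one_one] <;> field_simp <;> ring
  have hv_all : ∀ z, transvection 1 (g + 1) z ∈ H := by
    refine transvection_mem_of_eigenvector h2 hTH (c := g⁻¹) ?_ ?_ ?_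
      (mul_ne_zero (pow_ne_zero 2 hc) hz) hv
    · rw [T00, T01]; field_simp; ring
    · rw [T10, T11]; field_simp; ring
    · intro s hs
      obtain ⟨n, hn⟩ := hg s⁻¹ (inv_ne_zero hs)
      exact ⟨n, by rw [inv_pow, hn, inv_inv]⟩
  have hw_all : ∀ z, transvection (g + 2) (g + 1) z ∈ H := fun z =>
    transvection_conj_mem hA (hv_all z) (by simp; ring) (by simp)
  have hdet : 1 * (g + 1) - (g + 1) * (g + 2) ≠ 0 := by
    rw [show 1 * (g + 1) - (g + 1) * (g + 2) = -(g + 1) ^ 2 by ring]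
    exact neg_ne_zero.2 (pow_ne_zero 2 hg1')
  exact eq_top_of_root_subgroups (transvection_mem_of_independent hdet hv_all hw_all 1 0)
    (transvection_mem_of_independent hdet hv_all hw_all 0 1)

theorem eq_top_of_forall_eq_one_or_neg_one {H : Subgroup (SpecialLinearGroup (Fin 2) F)}
    (hF : ∀ s : F, s ≠ 0 → s = 1 ∨ s = -1)
    (hA : transvection 1 0 1 ∈ H) (hB : transvection 0 1 1 ∈ H) : H = ⊤ := by
  have key : ∀ a b : F, transvection a b 1 ∈ H → ∀ z, transvection a b z ∈ H := by
    intro a b h z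
    by_cases hz : z = 0
    · rw [hz, transvection_zero]
      exact H.one_mem
    · rcases hF z hz with rfl | rfl
      · exact h
      · rw [transvection_neg]
        exact H.inv_mem h
  exact eq_top_of_root_subgroups (key _ _ hA) (key _ _ hB)

end SLTwo

/-- If `F` is a finite field of odd cardinality, then there exist `x, y ∈ F` such that
the two shear matrices `[[1,x],[0,1]]` and `[[1,0],[y,1]]` generate `SL(2, F)`. -/
theorem SL2_odd_generated_by_two_shears
    (F : Type*) [Field F] [Fintype F] (hodd : Odd (Fintype.card F)) :
    ∃ x y : F,
      Subgroup.closure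
        ({⟨!![1, x; 0, 1], by simp [Matrix.det_fin_two_of]⟩,
          ⟨!![1, 0; y, 1], by simp [Matrix.det_fin_two_of]⟩} :
          Set (Matrix.SpecialLinearGroup (Fin 2) F)) = ⊤ := by
  have h2 : (2 : F) ≠ 0 := by
    refine Ring.two_ne_zero fun h => ?_
    rw [← Nat.not_even_iff_odd] at hodd
    exact hodd (FiniteField.even_card_iff_char_two.1 h |> Nat.even_iff.2)
  obtain ⟨u, hu⟩ := IsCyclic.exists_monoid_generator (α := Fˣ)
  have hg : ∀ s : F, s ≠ 0 → ∃ n : ℕ, (u : F) ^ n = s := by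
    intro s hs
    obtain ⟨n, hn⟩ := hu (Units.mk0 s hs)
    exact ⟨n, by simpa using congrArg Units.val hn⟩
  have hg1 : (u : F) - 1 ≠ 0 := by
    intro h
    obtain ⟨n, hn⟩ := hg (-1) (by simp)
    rw [sub_eq_zero.1 h, one_pow] at hn
    exact h2 (by linear_combination hn)
  by_cases hg1' : (u : F) + 1 = 0
  · refine ⟨1, -1, ?_⟩
    refine SLTwo.eq_top_of_forall_eq_one_or_neg_one ?_
      (Subgroup.subset_closure (Or.inl ?_)) (Subgroup.subset_closure (Or.inr ?_))
    · intro s hs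
      obtain ⟨n, rfl⟩ := hg s hs
      rw [eq_neg_of_add_eq_zero_left hg1']
      exact neg_one_pow_eq_or F n
    all_goals
      ext i j
      fin_cases i <;> fin_cases j <;> simp [SLTwo.transvection]
  · refine ⟨1, -(((u : F) + 1) ^ 2 / u), ?_⟩
    refine SLTwo.eq_top_of_generator h2 u.ne_zero hg1 hg1' hg
      (Subgroup.subset_closure (Or.inl ?_)) (Subgroup.subset_closure (Or.inr ?_)) <;>
    · ext i j
      fin_cases i <;> fin_cases j <;> simp [SLTwo.transvection]
end

section
/- Let F be a finite field and n ≥ 1. There exists a set of n invertible matrices over F, each differing from the n×n identity matrix in at most one row, which generates the general linear group GL(n,F). -/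
open Matrix

namespace Matrix.GeneralLinearGroup

open scoped commutatorElement

section Generators

variable {ι F : Type*} [Fintype ι] [DecidableEq ι] [Field F]

/-- The transvection `1 + c · E_{i,j}` as an element of the general linear group. -/
def elementary {i j : ι} (h : i ≠ j) (c : F) : GL ι F where
  val := Matrix.transvection i j c
  inv := Matrix.transvection i j (-c)
  val_inv := by simp [transvection_mul_transvection_same _ _ h]
  inv_val := by simp [transvection_mul_transvection_same _ _ h]

lemma coe_elementary {i j : ι} (h : i ≠ j) (c : F) :
    (elementary h c : Matrix ι ι F) = 1 + single i j c := rfl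

lemma elementary_zero {i j : ι} (h : i ≠ j) : elementary h (0 : F) = 1 :=
  Units.ext (by simp [coe_elementary])

lemma elementary_inv {i j : ι} (h : i ≠ j) (c : F) :
    (elementary h c)⁻¹ = elementary h (-c) := Units.ext rfl

lemma elementary_commutator {i j k : ι} (hij : i ≠ j) (hjk : j ≠ k) (hik : i ≠ k) (c d : F) :
    ⁅elementary hij c, elementary hjk d⁆ = elementary hik (c * d) := by
  rw [commutatorElement_def, mul_inv_eq_iff_eq_mul, mul_inv_eq_iff_eq_mul]
  ext1
  simp only [Units.val_mul, coe_elementary, add_mul, mul_add, one_mul, mul_one,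
    single_mul_single_same, single_mul_single_of_ne _ _ _ _ hjk.symm,
    single_mul_single_of_ne _ _ _ _ hik.symm, add_zero]
  abel

/-- Conjugation by a Weyl element exchanges opposite root subgroups. -/
lemma elementary_conj_opposite {i j : ι} (h : i ≠ j) (c : F) :
    (elementary h (-1) * elementary h.symm 1) * elementary h c *
      (elementary h (-1) * elementary h.symm 1)⁻¹ = elementary h.symm (-c) := by
  rw [mul_inv_eq_iff_eq_mul]
  ext1
  simp only [Units.val_mul, coe_elementary, add_mul, mul_add, one_mul, mul_one,
    single_mul_single_same, single_mul_single_of_ne _ _ _ _ h.symm,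
    single_mul_single_of_ne _ _ _ _ h, neg_mul, mul_neg, ← single_neg]
  abel

/-- Diagonal matrices with unit entries, inside the general linear group. -/
def diagonalHom (ι F : Type*) [Fintype ι] [DecidableEq ι] [Field F] : (ι → Fˣ) →* GL ι F :=
  (Units.map (diagonalRingHom ι F).toMonoidHom).comp MulEquiv.piUnits.symm.toMonoidHom

lemma coe_diagonalHom (d : ι → Fˣ) :
    (diagonalHom ι F d : Matrix ι ι F) = diagonal fun i => (d i : F) := rfl

lemma coe_diagonalHom_mulSingle (i : ι) (u : Fˣ) :
    (diagonalHom ι F (Pi.mulSingle i u) : Matrix ι ι F) = 1 + single i i ((u : F) - 1) := by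
  ext a b
  rw [coe_diagonalHom]
  by_cases hab : a = b <;> by_cases hai : i = a <;>
    simp_all [Pi.mulSingle_apply, eq_comm]

lemma diagonalHom_conj_elementary (d : ι → Fˣ) {i j : ι} (h : i ≠ j) (c : F) :
    diagonalHom ι F d * elementary h c * (diagonalHom ι F d)⁻¹ =
      elementary h (d i * (d j)⁻¹ * c) := by
  rw [mul_inv_eq_iff_eq_mul]
  ext a b
  simp only [Units.val_mul, coe_elementary, coe_diagonalHom, diagonal_mul, mul_diagonal,
    add_apply, one_apply, single_apply]
  have := (d j).ne_zero
  simp only [Units.val_inv_eq_inv_val]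
  split_ifs <;> grind

/-- Conjugation by a Weyl element exchanges diagonal entries. -/
lemma weyl_conj_diagonalHom {i j : ι} (h : i ≠ j) (u : Fˣ) :
    (elementary h 1 * elementary h.symm (-1) * elementary h 1) *
      diagonalHom ι F (Pi.mulSingle i u) *
      (elementary h 1 * elementary h.symm (-1) * elementary h 1)⁻¹ =
      diagonalHom ι F (Pi.mulSingle j u) := by
  rw [mul_inv_eq_iff_eq_mul]
  ext1
  simp only [Units.val_mul, coe_elementary, coe_diagonalHom_mulSingle, add_mul, mul_add, one_mul,
    mul_one, single_mul_single_same, single_mul_single_of_ne _ _ _ _ h.symm,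
    add_zero, neg_mul, mul_neg, ← single_neg, sub_eq_add_neg, single_add]
  abel

/-- All transvections together with all dilations along one coordinate generate `GL`. -/
lemma eq_top_of_elementary_mem (G : Subgroup (GL ι F))
    (hE : ∀ (i j : ι) (h : i ≠ j) (c : F), elementary h c ∈ G)
    (i : ι) (hD : ∀ u : Fˣ, diagonalHom ι F (Pi.mulSingle i u) ∈ G) : G = ⊤ := by
  have hdiag (d : ι → Fˣ) : diagonalHom ι F d ∈ G := by
    refine Subgroup.pi_mem_of_mulSingle_mem (H := G.comap (diagonalHom ι F)) d fun j => ?_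
    rw [Subgroup.mem_comap]
    obtain rfl | h := eq_or_ne i j
    · exact hD _
    · rw [← weyl_conj_diagonalHom h]
      have hw := G.mul_mem (G.mul_mem (hE i j h 1) (hE j i h.symm (-1))) (hE i j h 1)
      exact G.mul_mem (G.mul_mem hw (hD _)) (G.inv_mem hw)
  refine (Subgroup.eq_top_iff' G).2 fun g => ?_
  suffices H : ∃ x ∈ G, (x : Matrix ι ι F) = g by
    obtain ⟨x, hx, h⟩ := H
    rwa [← Units.ext h]
  refine diagonal_transvection_induction_of_det_ne_zero (fun M => ∃ x ∈ G, (x : Matrix ι ι F) = M)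
    g.1 ((isUnit_iff_isUnit_det _).1 g.isUnit).ne_zero (fun d hd => ?_)
    (fun t => ⟨_, hE t.i t.j t.hij t.c, rfl⟩) ?_
  · rw [det_diagonal, Finset.prod_ne_zero_iff] at hd
    exact ⟨_, hdiag fun j => Units.mk0 (d j) (hd j (Finset.mem_univ j)), rfl⟩
  · rintro _ _ - - ⟨x, hx, rfl⟩ ⟨y, hy, rfl⟩
    exact ⟨x * y, G.mul_mem hx hy, rfl⟩

end Generators

section Path

variable {F : Type*} [Field F] {m : ℕ}

/-- Transvections along a path generate those with entry `1` below the diagonal. -/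
lemma elementary_one_mem_of_lt {G : Subgroup (GL (Fin (m + 1)) F)}
    (hpath : ∀ i : Fin m, elementary (Fin.castSucc_lt_succ (i := i)).ne' (1 : F) ∈ G)
    {i j : Fin (m + 1)} (h : j < i) : elementary h.ne' (1 : F) ∈ G := by
  induction i using Fin.induction with
  | zero => exact absurd h (Fin.not_lt_zero j)
  | succ i ih =>
    obtain h' | rfl := (Fin.le_castSucc_iff.2 h).lt_or_eq
    · have := Subgroup.commutator_le_self G (Subgroup.commutator_mem_commutator (hpath i) (ih h'))
      rwa [elementary_commutator _ _ h.ne', mul_one] at this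
    · exact hpath i

lemma eq_top_of_path_mem {G : Subgroup (GL (Fin (m + 1)) F)} {α : Fˣ}
    (hα : ∀ u : Fˣ, u ∈ Subgroup.zpowers α)
    (hpath : ∀ i : Fin m, elementary (Fin.castSucc_lt_succ (i := i)).ne' (1 : F) ∈ G)
    (h0 : (0 : Fin (m + 1)) ≠ Fin.last m)
    (hfirst : elementary h0 1 * diagonalHom _ F (Pi.mulSingle 0 α) ∈ G) : G = ⊤ := by
  have hlow {i j : Fin (m + 1)} (h : j < i) := elementary_one_mem_of_lt hpath h
  have hpos {i : Fin (m + 1)} (h : i ≠ 0) : 0 < i := Fin.pos_iff_ne_zero.2 h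
  set D := diagonalHom (Fin (m + 1)) F (Pi.mulSingle 0 α)
  set T := elementary h0 (1 : F)
  have hL : elementary h0.symm (1 : F) ∈ G := hlow (hpos h0.symm)
  have conj {x y : GL (Fin (m + 1)) F} (hx : x ∈ G) (hy : y ∈ G) : x * y * x⁻¹ ∈ G :=
    G.mul_mem (G.mul_mem hx hy) (G.inv_mem hx)
  have hD0 (u : Fˣ) {j : Fin (m + 1)} (h : 0 ≠ j) (c : F) :
      diagonalHom _ F (Pi.mulSingle 0 u) * elementary h c *
        (diagonalHom _ F (Pi.mulSingle 0 u))⁻¹ = elementary h (u * c) := by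
    rw [diagonalHom_conj_elementary, Pi.mulSingle_eq_same, Pi.mulSingle_eq_of_ne h.symm]
    simp
  have hD0' (u : Fˣ) {j : Fin (m + 1)} (h : j ≠ 0) (c : F) :
      diagonalHom _ F (Pi.mulSingle 0 u) * elementary h c *
        (diagonalHom _ F (Pi.mulSingle 0 u))⁻¹ = elementary h ((u⁻¹ : Fˣ) * c) := by
    rw [diagonalHom_conj_elementary, Pi.mulSingle_eq_same, Pi.mulSingle_eq_of_ne h]
    simp
  have hbase : elementary h0 (-(α⁻¹ : Fˣ) : F) ∈ G := by
    have key : (elementary h0.symm 1)⁻¹ * (T * D) * elementary h0.symm 1 *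
        ((elementary h0.symm 1)⁻¹ * (T * D))⁻¹ = elementary h0 (-(α⁻¹ : Fˣ) : F) := by
      have hc := hD0' α h0.symm 1
      rw [mul_one] at hc
      rw [← elementary_conj_opposite h0.symm, ← hc, ← elementary_inv]
      simp only [T, D]
      group
    rw [← key]
    exact conj (G.mul_mem (G.inv_mem hL) hfirst) hL
  have hconj (c : F) : T * D * elementary h0 c * (T * D)⁻¹ = elementary h0 (α * c) := by
    have hcomm : T * elementary h0 (α * c) * T⁻¹ = elementary h0 (α * c) := by
      rw [mul_inv_eq_iff_eq_mul]
      ext1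
      simp only [T, Units.val_mul, coe_elementary, add_mul, mul_add, one_mul, mul_one,
        single_mul_single_of_ne _ _ _ _ h0.symm]
      abel
    rw [← hcomm, ← hD0 α h0 c]
    simp only [D]
    group
  have hpow (k : ℤ) (c : F) (hc : elementary h0 c ∈ G) :
      elementary h0 (((α ^ k : Fˣ) : F) * c) ∈ G := by
    induction k with
    | zero => simpa using hc
    | succ k ih =>
      have := conj hfirst ih
      rwa [hconj, ← mul_assoc, ← Units.val_mul, mul_self_zpow] at this
    | pred k ih =>
      have := conj (G.inv_mem hfirst) ih
      convert this using 1
      rw [inv_inv, mul_assoc, eq_inv_mul_iff_mul_eq, ← mul_inv_eq_iff_eq_mul, hconj, ← mul_assoc,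
        ← Units.val_mul, mul_self_zpow, sub_add_cancel]
  have hlast (c : F) : elementary h0 c ∈ G := by
    obtain rfl | hc := eq_or_ne c 0
    · rw [elementary_zero]
      exact G.one_mem
    · obtain ⟨k, hk⟩ := Subgroup.mem_zpowers_iff.1 (hα (-Units.mk0 c hc * α))
      have := hpow k _ hbase
      rw [hk] at this
      simpa using this
  have hD (u : Fˣ) : diagonalHom _ F (Pi.mulSingle 0 u) ∈ G := by
    obtain ⟨k, rfl⟩ := Subgroup.mem_zpowers_iff.1 (hα u)
    rw [Pi.mulSingle_zpow, map_zpow]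
    exact G.zpow_mem ((G.mul_mem_cancel_left (hlast 1)).1 hfirst) k
  have hrow {j : Fin (m + 1)} (h : 0 ≠ j) (c : F) : elementary h c ∈ G := by
    obtain rfl | hj := eq_or_ne j (Fin.last m)
    · exact hlast c
    · have := Subgroup.commutator_le_self G (Subgroup.commutator_mem_commutator (hlast c)
        (hlow (Fin.lt_last_iff_ne_last.2 hj)))
      rwa [elementary_commutator _ _ h, mul_one] at this
  have hcol {i : Fin (m + 1)} (h : i ≠ 0) (c : F) : elementary h c ∈ G := by
    obtain rfl | hc := eq_or_ne c 0
    · rw [elementary_zero]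
      exact G.one_mem
    · have := conj (hD (Units.mk0 c hc)⁻¹) (hlow (hpos h))
      rw [hD0'] at this
      simpa using this
  refine eq_top_of_elementary_mem G (fun i j h c => ?_) 0 hD
  obtain rfl | hi := eq_or_ne i 0
  · exact hrow h c
  obtain rfl | hj := eq_or_ne j 0
  · exact hcol h c
  have := Subgroup.commutator_le_self G (Subgroup.commutator_mem_commutator (hcol hi 1)
    (hrow hj.symm c))
  rwa [elementary_commutator _ _ h, one_mul] at this

/-- One instruction per row: a dilation-plus-transvection in the first row, and transvections
along the path `0, 1, …, m` in the other rows. -/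
def pathInstruction (α : Fˣ) (h0 : (0 : Fin (m + 1)) ≠ Fin.last m) :
    Fin (m + 1) → GL (Fin (m + 1)) F :=
  Fin.cons (elementary h0 1 * diagonalHom _ F (Pi.mulSingle 0 α))
    fun i => elementary (Fin.castSucc_lt_succ (i := i)).ne' 1

lemma coe_pathInstruction_zero (α : Fˣ) (h0 : (0 : Fin (m + 1)) ≠ Fin.last m) :
    (pathInstruction α h0 0 : Matrix (Fin (m + 1)) (Fin (m + 1)) F) =
      1 + single 0 0 ((α : F) - 1) + single 0 (Fin.last m) 1 := by
  simp [pathInstruction, coe_elementary, coe_diagonalHom_mulSingle, add_mul, mul_add, h0.symm,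
    add_right_comm]

lemma pathInstruction_row_of_ne (α : Fˣ) (h0 : (0 : Fin (m + 1)) ≠ Fin.last m)
    {i j : Fin (m + 1)} (h : j ≠ i) :
    (pathInstruction α h0 i : Matrix (Fin (m + 1)) (Fin (m + 1)) F) j =
      (1 : Matrix (Fin (m + 1)) (Fin (m + 1)) F) j := by
  ext k
  cases i using Fin.cases with
  | zero => simp [coe_pathInstruction_zero, h.symm]
  | succ i => simp [pathInstruction, coe_elementary, h.symm]

lemma pathInstruction_row_self_ne (α : Fˣ) (h0 : (0 : Fin (m + 1)) ≠ Fin.last m)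
    (i : Fin (m + 1)) : (pathInstruction α h0 i : Matrix (Fin (m + 1)) (Fin (m + 1)) F) i ≠
      (1 : Matrix (Fin (m + 1)) (Fin (m + 1)) F) i := by
  intro h
  cases i using Fin.cases with
  | zero => simpa [coe_pathInstruction_zero, h0] using congrFun h (Fin.last m)
  | succ i => simpa [pathInstruction, coe_elementary] using congrFun h i.castSucc

lemma pathInstruction_injective (α : Fˣ) (h0 : (0 : Fin (m + 1)) ≠ Fin.last m) :
    Function.Injective (pathInstruction α h0) := by
  intro i j h
  by_contra hij
  exact pathInstruction_row_self_ne α h0 i (h ▸ pathInstruction_row_of_ne α h0 hij)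

end Path

end Matrix.GeneralLinearGroup

/-- For every finite field `F` and `n ≥ 1`, the group `GL(n, F)` is generated by a set
of `n` bijective linear instructions. -/
theorem GL_generated_by_n_instructions
    (F : Type*) [Field F] [Fintype F] (n : ℕ) (hn : 1 ≤ n) :
    ∃ S : Finset (Matrix.GeneralLinearGroup (Fin n) F),
      S.card = n ∧
      (∀ A ∈ S, Matrix.IsLinearInstruction (A : Matrix (Fin n) (Fin n) F)) ∧
      Subgroup.closure (S : Set (Matrix.GeneralLinearGroup (Fin n) F)) = ⊤ := by
  classical
  obtain ⟨m, rfl⟩ : ∃ m, n = m + 1 := ⟨n - 1, by omega⟩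
  obtain ⟨α, hα⟩ := IsCyclic.exists_generator (α := Fˣ)
  open Matrix.GeneralLinearGroup in
  by_cases h0 : (0 : Fin (m + 1)) = Fin.last m
  · obtain rfl : m = 0 := (congrArg Fin.val h0).symm
    refine ⟨{diagonalHom _ F (Pi.mulSingle 0 α)}, rfl, fun A _ => ⟨0, fun j hj => ?_⟩, ?_⟩
    · exact absurd (Fin.fin_one_eq_zero j) hj
    · refine eq_top_of_elementary_mem _ (fun i j h => absurd (by omega) h) 0
        fun u => ?_
      obtain ⟨k, rfl⟩ := Subgroup.mem_zpowers_iff.1 (hα u)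
      rw [Pi.mulSingle_zpow, map_zpow]
      exact Subgroup.zpow_mem _ (Subgroup.subset_closure (by simp)) k
  · refine ⟨Finset.univ.image (pathInstruction α h0), ?_, fun A hA => ?_, ?_⟩
    · rw [Finset.card_image_of_injective _ (pathInstruction_injective α h0), Finset.card_fin]
    · obtain ⟨i, -, rfl⟩ := Finset.mem_image.1 hA
      exact ⟨i, fun j hj => pathInstruction_row_of_ne α h0 hj⟩
    · have hmem (i : Fin (m + 1)) : pathInstruction α h0 i ∈ Subgroup.closure
          ((Finset.univ.image (pathInstruction α h0) : Finset (GL (Fin (m + 1)) F)) :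
            Set (GL (Fin (m + 1)) F)) :=
        Subgroup.subset_closure (by simp)
      exact eq_top_of_path_mem hα (fun i => hmem i.succ) h0 (hmem 0)
end

section
/- Let F be a finite field and let M be an invertible 2×2 matrix over F. Then M can be written as a product of at most two invertible matrices each differing from the 2×2 identity matrix in at most one row if and only if at least one diagonal entry of M is nonzero. Equivalently, the matrices in GL(2,F) requiring exactly three bijective linear instructions are exactly the antidiagonal matrices [[0,b],[c,0]] with b, c ≠ 0. -/
open Matrix

namespace Matrix

variable {F : Type*} [Field F]

/-- The linear instruction replacing the first coordinate. -/
theorem isLinearInstruction_row_zero (a b : F) :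
    (!![a, b; 0, 1] : Matrix (Fin 2) (Fin 2) F).IsLinearInstruction := by
  refine ⟨0, fun i hi => ?_⟩
  obtain rfl : i = 1 := by omega
  ext j
  fin_cases j <;> simp [one_fin_two]

/-- The linear instruction replacing the second coordinate. -/
theorem isLinearInstruction_row_one (c d : F) :
    (!![1, 0; c, d] : Matrix (Fin 2) (Fin 2) F).IsLinearInstruction := by
  refine ⟨1, fun i hi => ?_⟩
  obtain rfl : i = 0 := by omega
  ext j
  fin_cases j <;> simp [one_fin_two]

theorem IsLinearInstruction.exists_row_eq_one {A : Matrix (Fin 2) (Fin 2) F}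
    (hA : A.IsLinearInstruction) :
    (A 1 0 = 0 ∧ A 1 1 = 1) ∨ (A 0 0 = 1 ∧ A 0 1 = 0) := by
  obtain ⟨i, hi⟩ := hA
  fin_cases i
  · have h := hi 1 (by simp)
    exact Or.inl ⟨by simp [h], by simp [h]⟩
  · have h := hi 0 (by simp)
    exact Or.inr ⟨by simp [h], by simp [h]⟩

theorem IsLinearInstruction.diag_ne_zero {A : Matrix (Fin 2) (Fin 2) F}
    (hA : A.IsLinearInstruction) (hu : IsUnit A) : A 0 0 ≠ 0 ∧ A 1 1 ≠ 0 := by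
  rw [isUnit_iff_isUnit_det, isUnit_iff_ne_zero, det_fin_two] at hu
  refine mul_ne_zero_iff.mp ?_
  rcases hA.exists_row_eq_one with ⟨h, -⟩ | ⟨-, h⟩ <;> simpa [h] using hu

theorem diag_ne_zero_of_prod_linearInstructions {L : List (Matrix (Fin 2) (Fin 2) F)}
    (hlen : L.length ≤ 2) (hL : ∀ A ∈ L, IsUnit A ∧ A.IsLinearInstruction) :
    L.prod 0 0 ≠ 0 ∨ L.prod 1 1 ≠ 0 := by
  match L, hlen, hL with
  | [], _, _ => simp
  | [A], _, hL =>
    obtain ⟨hu, hA⟩ := hL A (by simp)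
    simpa using Or.inl (hA.diag_ne_zero hu).1
  | [A, B], _, hL =>
    obtain ⟨-, hA⟩ := hL A (by simp)
    obtain ⟨hu, hB⟩ := hL B (by simp)
    obtain ⟨h0, h1⟩ := hB.diag_ne_zero hu
    rcases hA.exists_row_eq_one with ⟨h, h'⟩ | ⟨h, h'⟩
    · right
      simpa [mul_apply, Fin.sum_univ_two, h, h'] using h1
    · left
      simpa [mul_apply, Fin.sum_univ_two, h, h'] using h0

theorem exists_linearInstructions_of_diag_ne_zero {M : Matrix (Fin 2) (Fin 2) F}
    (hM : IsUnit M) (h : M 0 0 ≠ 0 ∨ M 1 1 ≠ 0) :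
    ∃ L : List (Matrix (Fin 2) (Fin 2) F),
      L.length ≤ 2 ∧ (∀ A ∈ L, IsUnit A ∧ A.IsLinearInstruction) ∧ L.prod = M := by
  suffices ∃ A B : Matrix (Fin 2) (Fin 2) F,
      A.IsLinearInstruction ∧ B.IsLinearInstruction ∧ A * B = M by
    obtain ⟨A, B, hA, hB, rfl⟩ := this
    rw [isUnit_iff_isUnit_det, det_mul, IsUnit.mul_iff, ← isUnit_iff_isUnit_det,
      ← isUnit_iff_isUnit_det] at hM
    exact ⟨[A, B], by simp, by simp [hM, hA, hB], by simp⟩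
  rcases h with h | h
  · refine ⟨_, _, isLinearInstruction_row_one (M 1 0 / M 0 0) (M 1 1 - M 1 0 / M 0 0 * M 0 1),
      isLinearInstruction_row_zero (M 0 0) (M 0 1), ?_⟩
    ext i j
    fin_cases i <;> fin_cases j <;> simp [h]
  · refine ⟨_, _, isLinearInstruction_row_zero (M 0 0 - M 0 1 / M 1 1 * M 1 0) (M 0 1 / M 1 1),
      isLinearInstruction_row_one (M 1 0) (M 1 1), ?_⟩
    ext i j
    fin_cases i <;> fin_cases j <;> simp [h]

/-- An invertible `2 × 2` matrix has zero diagonal iff it is antidiagonal with nonzero entries. -/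
theorem diag_eq_zero_iff_antidiagonal {M : Matrix (Fin 2) (Fin 2) F} (hM : IsUnit M) :
    (¬ (M 0 0 ≠ 0 ∨ M 1 1 ≠ 0)) ↔ ∃ b c : F, b ≠ 0 ∧ c ≠ 0 ∧ M = !![0, b; c, 0] := by
  constructor
  · intro h
    obtain ⟨h0, h1⟩ : M 0 0 = 0 ∧ M 1 1 = 0 := by simpa using h
    rw [isUnit_iff_isUnit_det, isUnit_iff_ne_zero, det_fin_two] at hM
    obtain ⟨hb, hc⟩ : M 0 1 ≠ 0 ∧ M 1 0 ≠ 0 := by simpa [h0] using hM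
    refine ⟨M 0 1, M 1 0, hb, hc, ?_⟩
    simpa only [h0, h1] using eta_fin_two M
  · rintro ⟨b, c, -, -, rfl⟩
    simp

end Matrix

/-- An invertible `2 × 2` matrix over a finite field is a product of at most two
bijective linear instructions iff it has a nonzero diagonal entry; equivalently the
matrices requiring three instructions are exactly the antidiagonal ones
`[[0,b],[c,0]]` with `b, c ≠ 0`. -/
theorem GL2_complexity_two_iff_nonzero_diagonal
    (F : Type*) [Field F] [Fintype F]
    (M : Matrix (Fin 2) (Fin 2) F) (hM : IsUnit M) :
    ((∃ L : List (Matrix (Fin 2) (Fin 2) F),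
        L.length ≤ 2 ∧ (∀ A ∈ L, IsUnit A ∧ A.IsLinearInstruction) ∧ L.prod = M) ↔
      (M 0 0 ≠ 0 ∨ M 1 1 ≠ 0)) ∧
    ((¬ ∃ L : List (Matrix (Fin 2) (Fin 2) F),
        L.length ≤ 2 ∧ (∀ A ∈ L, IsUnit A ∧ A.IsLinearInstruction) ∧ L.prod = M) ↔
      ∃ b c : F, b ≠ 0 ∧ c ≠ 0 ∧ M = !![0, b; c, 0]) := by
  have key : (∃ L : List (Matrix (Fin 2) (Fin 2) F),
      L.length ≤ 2 ∧ (∀ A ∈ L, IsUnit A ∧ A.IsLinearInstruction) ∧ L.prod = M) ↔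
      (M 0 0 ≠ 0 ∨ M 1 1 ≠ 0) := by
    refine ⟨?_, exists_linearInstructions_of_diag_ne_zero hM⟩
    rintro ⟨L, hlen, hL, rfl⟩
    exact diag_ne_zero_of_prod_linearInstructions hlen hL
  exact ⟨key, key.not.trans (diag_eq_zero_iff_antidiagonal hM)⟩
end

section
/- Let F be a finite field and n ≥ 2. There exists a set of n+1 matrices over F, each differing from the n×n identity matrix in at most one row, whose generated multiplicative submonoid is the full monoid of all n×n matrices over F. In other words, the general linear semigroup GLS(n,F) = GL(n,F) ∪ Sing(n,F), which equals the set of all n×n matrices over F, is generated as a monoid by n+1 linear instructions. -/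
open Matrix

namespace Matrix

section Identities

variable {ι F : Type*} [DecidableEq ι] [Field F]

/-- The diagonal matrix scaling the `i`-th coordinate by `s` and fixing the others. -/
def dilation (i : ι) (s : F) : Matrix ι ι F :=
  1 + single i i (s - 1)

theorem dilation_one (i : ι) : dilation i (1 : F) = 1 := by
  simp [dilation]

variable (ι F) in
theorem exists_forall_single_eq_smul :
    ∃ E : ι → ι → Matrix ι ι F, ∀ i j c, single i j c = c • E i j :=
  ⟨fun i j ↦ single i j 1, fun i j c ↦ by simp [smul_single]⟩

variable [Fintype ι]

theorem dilation_mul_dilation (i : ι) (s r : F) :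
    dilation i s * dilation i r = dilation i (s * r) := by
  obtain ⟨E, hE⟩ := exists_forall_single_eq_smul ι F
  simp only [dilation, mul_add, add_mul, single_mul_single_same, one_mul, mul_one]
  simp only [hE]
  module

theorem isUnit_dilation (i : ι) {s : F} (hs : s ≠ 0) : IsUnit (dilation i s) := by
  refine IsUnit.of_mul_eq_one (dilation i s⁻¹) ?_
  rw [dilation_mul_dilation, mul_inv_cancel₀ hs, dilation_one]

theorem isUnit_transvection {i j : ι} (hij : i ≠ j) (c : F) : IsUnit (transvection i j c) := by
  refine IsUnit.of_mul_eq_one (transvection i j (-c)) ?_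
  rw [transvection_mul_transvection_same _ _ hij, add_neg_cancel, transvection_zero]

theorem dilation_mul_diagonal (i : ι) (s : F) (d : ι → F) :
    dilation i s * diagonal d = diagonal (Function.update d i (s * d i)) := by
  ext a b
  by_cases hab : a = b
  · subst hab
    by_cases hai : a = i
    · subst hai
      simp [dilation]
    · simp [dilation, hai, Ne.symm hai]
  · by_cases hai : a = i
    · subst hai
      simp [dilation, hab]
    · simp [dilation, hab, Ne.symm hai]

theorem transvection_mul_transvection_of_ne {i j k : ι} (hik : i ≠ k) (hjk : j ≠ k) (a b : F) :
    transvection i k (a * b) * (transvection j k b * transvection i j a) =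
      transvection i j a * transvection j k b := by
  simp only [transvection, mul_add, add_mul, one_mul, mul_one, single_mul_single_same,
    single_mul_single_of_ne _ _ _ _ hik.symm, single_mul_single_of_ne _ _ _ _ hjk.symm, add_zero]
  abel

/-- The product `xyx` of transvections representing the Weyl reflection that exchanges
the coordinates `i` and `j`. -/
def weylReflection (i j : ι) (c : F) : Matrix ι ι F :=
  transvection j i c * transvection i j (-c⁻¹) * transvection j i c

theorem isUnit_weylReflection {i j : ι} (hij : i ≠ j) (c : F) : IsUnit (weylReflection i j c) :=
  ((isUnit_transvection hij.symm _).mul (isUnit_transvection hij _)).mul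
    (isUnit_transvection hij.symm _)

theorem weylReflection_eq {i j : ι} (hij : i ≠ j) {c : F} (hc : c ≠ 0) :
    weylReflection i j c =
      1 - single i i 1 - single j j 1 + single j i c - single i j c⁻¹ := by
  obtain ⟨E, hE⟩ := exists_forall_single_eq_smul ι F
  simp only [weylReflection, transvection, mul_add, add_mul, one_mul, mul_one,
    single_mul_single_same, single_mul_single_of_ne _ _ _ _ hij]
  simp only [hE, mul_neg, neg_mul, mul_inv_cancel₀ hc, inv_mul_cancel₀ hc]
  module

theorem transvection_mul_weylReflection {i j : ι} (hij : i ≠ j) {c : F} (hc : c ≠ 0) (t : F) :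
    transvection j i (-c ^ 2 * t) * weylReflection i j c =
      weylReflection i j c * transvection i j t := by
  obtain ⟨E, hE⟩ := exists_forall_single_eq_smul ι F
  have h : -c ^ 2 * t * c⁻¹ = -(c * t) := by field_simp
  rw [weylReflection_eq hij hc]
  simp only [transvection, mul_add, add_mul, mul_sub, sub_mul, one_mul, mul_one,
    single_mul_single_same, single_mul_single_of_ne _ _ _ _ hij,
    single_mul_single_of_ne _ _ _ _ hij.symm, h]
  simp only [hE]
  module

theorem dilation_mul_weylReflection {i j : ι} (hij : i ≠ j) {c : F} (hc : c ≠ 0) (s : F) :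
    dilation j s * weylReflection i j c = weylReflection i j c * dilation i s := by
  rw [weylReflection_eq hij hc]
  simp only [dilation, mul_add, add_mul, mul_sub, sub_mul, one_mul, mul_one,
    single_mul_single_same, single_mul_single_of_ne _ _ _ _ hij.symm]
  rw [mul_comm c]
  abel

/-- The matrix of the instruction `x i ← s * x i + b * x j`. -/
def scaleAdd (i j : ι) (s b : F) : Matrix ι ι F :=
  transvection i j b * dilation i s

theorem isUnit_scaleAdd {i j : ι} (hij : i ≠ j) {s : F} (hs : s ≠ 0) (b : F) :
    IsUnit (scaleAdd i j s b) :=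
  (isUnit_transvection hij b).mul (isUnit_dilation i hs)

theorem scaleAdd_eq {i j : ι} (hij : i ≠ j) (s b : F) :
    scaleAdd i j s b = 1 + single i i (s - 1) + single i j b := by
  simp only [scaleAdd, transvection, dilation, mul_add, add_mul, one_mul, mul_one,
    single_mul_single_of_ne _ _ _ _ hij.symm, add_zero]
  abel

theorem scaleAdd_mul_scaleAdd {i j : ι} (hij : i ≠ j) (s b r d : F) :
    scaleAdd i j s b * scaleAdd i j r d = scaleAdd i j (s * r) (b + s * d) := by
  obtain ⟨E, hE⟩ := exists_forall_single_eq_smul ι F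
  simp only [scaleAdd_eq hij, mul_add, add_mul, one_mul, mul_one, single_mul_single_same,
    single_mul_single_of_ne _ _ _ _ hij.symm]
  simp only [hE]
  module

theorem transvection_mul_scaleAdd {i j : ι} (hij : i ≠ j) (s b t : F) :
    transvection i j (s * t) * scaleAdd i j s b = scaleAdd i j s b * transvection i j t := by
  obtain ⟨E, hE⟩ := exists_forall_single_eq_smul ι F
  simp only [scaleAdd_eq hij, transvection, mul_add, add_mul, one_mul, mul_one,
    single_mul_single_same, single_mul_single_of_ne _ _ _ _ hij.symm]
  simp only [hE]
  module

/-- The unit `transvection j i 1 * scaleAdd i j s (-1)` conjugates a transvection along `(j, i)`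
to one along `(i, j)`. -/
theorem transvection_mul_transvection_mul_scaleAdd {i j : ι} (hij : i ≠ j) {s : F} (hs : s ≠ 0) :
    transvection i j (-s⁻¹) * (transvection j i 1 * scaleAdd i j s (-1)) =
      (transvection j i 1 * scaleAdd i j s (-1)) * transvection j i 1 := by
  obtain ⟨E, hE⟩ := exists_forall_single_eq_smul ι F
  simp only [scaleAdd_eq hij, transvection, mul_add, add_mul, one_mul, mul_one,
    single_mul_single_same, single_mul_single_of_ne _ _ _ _ hij,
    single_mul_single_of_ne _ _ _ _ hij.symm]
  simp only [hE]
  match_scalars <;> field_simp <;> ring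

end Identities

section Submonoid

theorem _root_.Submonoid.mem_of_mul_mem_of_isUnit {M : Type*} [Monoid M] [Finite M]
    (G : Submonoid M) {a b : M} (ha : a ∈ G) (hu : IsUnit a) (hba : b * a ∈ G) : b ∈ G := by
  obtain ⟨u, rfl⟩ := hu
  obtain ⟨k, hk, huk⟩ := (isOfFinOrder_of_finite u).exists_pow_eq_one
  have hinv : (↑u⁻¹ : M) ∈ G := by
    have : u⁻¹ = u ^ (k - 1) := by
      rw [inv_eq_iff_mul_eq_one, ← pow_succ', Nat.sub_add_cancel hk, huk]
    rw [this, Units.val_pow_eq_pow_val]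
    exact pow_mem ha _
  simpa using mul_mem hba hinv

variable {ι F : Type*} [Fintype ι] [DecidableEq ι] [Field F]

theorem eq_top_of_transvection_mem_of_dilation_mem {G : Submonoid (Matrix ι ι F)}
    (hT : ∀ i j, i ≠ j → ∀ t, transvection i j t ∈ G) (hD : ∀ i s, dilation i s ∈ G) :
    G = ⊤ := by
  rw [eq_top_iff]
  intro M _
  refine diagonal_transvection_induction (· ∈ G) M (fun d _ ↦ ?_) (fun t ↦ hT _ _ t.hij _)
    (fun _ _ ↦ mul_mem)
  have key : ∀ s : Finset ι, diagonal (fun i ↦ if i ∈ s then d i else 1) ∈ G := by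
    intro s
    induction s using Finset.induction_on with
    | empty => simp
    | insert a s ha ih =>
      have h := mul_mem (hD a (d a)) ih
      rw [dilation_mul_diagonal] at h
      convert h using 2
      ext i
      by_cases hi : i = a
      · subst hi
        simp [ha]
      · simp [hi]
  simpa using key Finset.univ

variable [Finite F] {G : Submonoid (Matrix ι ι F)}

theorem transvection_mul_mem {i j k : ι} (hij : i ≠ j) (hik : i ≠ k) (hjk : j ≠ k)
    {a b : F} (ha : transvection i j a ∈ G) (hb : transvection j k b ∈ G) :
    transvection i k (a * b) ∈ G := by
  refine G.mem_of_mul_mem_of_isUnit (mul_mem hb ha)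
    ((isUnit_transvection hjk b).mul (isUnit_transvection hij a)) ?_
  rw [transvection_mul_transvection_of_ne hik hjk]
  exact mul_mem ha hb

theorem forall_transvection_mem_swap {i j : ι} (hij : i ≠ j) {c : F} (hc : c ≠ 0)
    (h : ∀ t, transvection i j t ∈ G) (hji : transvection j i c ∈ G) (t : F) :
    transvection j i t ∈ G := by
  have hw : weylReflection i j c ∈ G := mul_mem (mul_mem hji (h _)) hji
  refine G.mem_of_mul_mem_of_isUnit hw (isUnit_weylReflection hij c) ?_
  have : t = -c ^ 2 * (-(c ^ 2)⁻¹ * t) := by field_simp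
  rw [this, transvection_mul_weylReflection hij hc]
  exact mul_mem hw (h _)

theorem dilation_mem_of_dilation_mem {i j : ι} (hij : i ≠ j)
    (h : ∀ t, transvection i j t ∈ G) (h' : ∀ t, transvection j i t ∈ G) {s : F}
    (hs : dilation i s ∈ G) : dilation j s ∈ G := by
  have hw : weylReflection i j 1 ∈ G := mul_mem (mul_mem (h' _) (h _)) (h' _)
  refine G.mem_of_mul_mem_of_isUnit hw (isUnit_weylReflection hij 1) ?_
  rw [dilation_mul_weylReflection hij one_ne_zero]
  exact mul_mem hw hs

theorem forall_transvection_mem_of_scaleAdd_mem {i j : ι} (hij : i ≠ j) {a b : F}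
    (ha : ∀ t : F, t ≠ 0 → ∃ k : ℕ, a ^ k = t) (ha0 : a ≠ 0) (hab : scaleAdd i j a b ∈ G)
    {c : F} (hc : c ≠ 0) (h : transvection i j c ∈ G) (t : F) : transvection i j t ∈ G := by
  have key : ∀ k : ℕ, transvection i j (a ^ k * c) ∈ G := by
    intro k
    induction k with
    | zero => simpa using h
    | succ k ih =>
      refine G.mem_of_mul_mem_of_isUnit hab (isUnit_scaleAdd hij ha0 b) ?_
      rw [pow_succ', mul_assoc, transvection_mul_scaleAdd hij]
      exact mul_mem hab ih
  by_cases ht : t = 0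
  · simp [ht]
  · obtain ⟨k, hk⟩ := ha (t / c) (div_ne_zero ht hc)
    have := key k
    rwa [hk, div_mul_cancel₀ _ hc] at this

theorem forall_transvection_mem_of_scaleAdd_mem_of_transvection_mem {i j : ι} (hij : i ≠ j)
    {a b : F} (ha : ∀ t : F, t ≠ 0 → ∃ k : ℕ, a ^ k = t) (ha0 : a ≠ 0)
    (hb : a = 1 ∧ b = 1 ∨ a ≠ 1 ∧ b = a * (a - 1))
    (hab : scaleAdd i j a b ∈ G) (hji : transvection j i 1 ∈ G) (t : F) :
    transvection i j t ∈ G := by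
  obtain ⟨ha1, hb⟩ | ⟨ha1, hb⟩ := hb
  · refine forall_transvection_mem_of_scaleAdd_mem hij ha ha0 hab one_ne_zero ?_ t
    simpa [hb, ha1, scaleAdd, dilation_one] using hab
  · have hpow : ∀ k : ℕ, scaleAdd i j (a ^ k) (a * (a ^ k - 1)) ∈ G := by
      intro k
      induction k with
      | zero => simp [scaleAdd, dilation_one]
      | succ k ih =>
        have h := mul_mem hab ih
        rw [scaleAdd_mul_scaleAdd hij, hb] at h
        convert h using 2 <;> ring
    have hs0 : (a - 1) / a ≠ 0 := div_ne_zero (sub_ne_zero.2 ha1) ha0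
    obtain ⟨k, hk⟩ := ha _ hs0
    have hg : scaleAdd i j ((a - 1) / a) (-1) ∈ G := by
      have h := hpow k
      rw [hk] at h
      convert h using 2
      field_simp
      ring
    refine forall_transvection_mem_of_scaleAdd_mem hij ha ha0 hab
      (neg_ne_zero.2 (inv_ne_zero hs0)) ?_ t
    refine G.mem_of_mul_mem_of_isUnit (mul_mem hji hg)
      ((isUnit_transvection hij.symm 1).mul (isUnit_scaleAdd hij hs0 _)) ?_
    rw [transvection_mul_transvection_mul_scaleAdd hij hs0]
    exact mul_mem (mul_mem hji hg) hji

end Submonoid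

section Generators

variable {F : Type*} [Field F] {m : ℕ}

/-- The `i`-th invertible instruction: it adds coordinate `i + 1` to coordinate `i`, except that
for the last `i` it is `x i ← a * x i + b * x 0`. -/
def cyclicInstruction (a b : F) (i : Fin (m + 2)) : Matrix (Fin (m + 2)) (Fin (m + 2)) F :=
  if i = Fin.last (m + 1) then scaleAdd i 0 a b else transvection i (i + 1) 1

theorem cyclicInstruction_apply_of_ne (a b : F) {i j : Fin (m + 2)} (h : j ≠ i) :
    cyclicInstruction a b i j = (1 : Matrix (Fin (m + 2)) (Fin (m + 2)) F) j := by
  ext k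
  unfold cyclicInstruction
  split_ifs with hi
  · rw [scaleAdd_eq (by rw [hi]; exact Fin.last_pos.ne')]
    simp [h.symm]
  · simp [transvection, h.symm]

theorem cyclicInstruction_apply_add_one_ne_zero (a : F) {b : F} (hb : b ≠ 0) (i : Fin (m + 2)) :
    cyclicInstruction a b i i (i + 1) ≠ 0 := by
  have hne : i ≠ i + 1 := by simp
  unfold cyclicInstruction
  split_ifs with hi
  · subst hi
    rw [scaleAdd_eq Fin.last_pos.ne']
    simp [Fin.last_pos.ne', hb]
  · simp [transvection, hne]

theorem cyclicInstruction_injective (a : F) {b : F} (hb : b ≠ 0) :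
    Function.Injective (cyclicInstruction (m := m) a b) := by
  intro i j hij
  by_contra hne
  apply cyclicInstruction_apply_add_one_ne_zero a hb i
  rw [hij, cyclicInstruction_apply_of_ne a b hne]
  simp

theorem dilation_ne_cyclicInstruction (a : F) {b : F} (hb : b ≠ 0) (l i : Fin (m + 2)) (s : F) :
    dilation l s ≠ cyclicInstruction a b i := by
  intro h
  apply cyclicInstruction_apply_add_one_ne_zero a hb i
  rw [← h]
  have : i ≠ i + 1 := by simp
  by_cases hl : l = i
  · simp [dilation, hl, this]
  · simp [dilation, hl, this]

variable [Finite F] {G : Submonoid (Matrix (Fin (m + 2)) (Fin (m + 2)) F)}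

theorem transvection_mem_of_lt (h : ∀ i : Fin (m + 1), transvection i.castSucc i.succ 1 ∈ G)
    {i j : Fin (m + 2)} (hij : i < j) : transvection i j 1 ∈ G := by
  induction j using Fin.induction with
  | zero => exact absurd hij (Fin.not_lt_zero i)
  | succ j ih =>
    rcases (Fin.le_castSucc_iff.2 hij).eq_or_lt with rfl | hlt
    · exact h j
    · simpa using transvection_mul_mem hlt.ne hij.ne j.castSucc_lt_succ.ne (ih hlt) (h j)

theorem eq_top_of_cyclicInstruction_mem {a b : F} (ha : ∀ t : F, t ≠ 0 → ∃ k : ℕ, a ^ k = t)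
    (ha0 : a ≠ 0) (hb : a = 1 ∧ b = 1 ∨ a ≠ 1 ∧ b = a * (a - 1))
    (hG : ∀ i, cyclicInstruction a b i ∈ G) (hD : dilation (Fin.last (m + 1)) 0 ∈ G) : G = ⊤ := by
  set l := Fin.last (m + 1) with hl
  have hl0 : l ≠ 0 := Fin.last_pos.ne'
  have hH : scaleAdd l 0 a b ∈ G := by simpa [cyclicInstruction, hl] using hG l
  have hU : ∀ {i j : Fin (m + 2)}, i < j → transvection i j (1 : F) ∈ G := by
    refine transvection_mem_of_lt fun i ↦ ?_
    simpa [cyclicInstruction, i.castSucc_lt_last.ne] using hG i.castSucc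
  have hl0T : ∀ t, transvection l 0 t ∈ G :=
    forall_transvection_mem_of_scaleAdd_mem_of_transvection_mem hl0 ha ha0 hb hH
      (hU Fin.last_pos)
  have hlT : ∀ j, l ≠ j → ∀ t, transvection l j t ∈ G := by
    intro j hj t
    by_cases hj0 : j = 0
    · exact hj0 ▸ hl0T t
    · simpa using transvection_mul_mem hl0 hj (Ne.symm hj0) (hl0T t) (hU (Fin.pos_of_ne_zero hj0))
  have hTl : ∀ i, i ≠ l → ∀ t, transvection i l t ∈ G := by
    intro i hi
    exact forall_transvection_mem_swap hi.symm one_ne_zero (hlT i hi.symm)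
      (hU (Fin.lt_last_iff_ne_last.2 hi))
  have hT : ∀ i j, i ≠ j → ∀ t, transvection i j t ∈ G := by
    intro i j hij t
    by_cases hi : i = l
    · exact hi ▸ hlT j (hi ▸ hij) t
    by_cases hj : j = l
    · exact hj ▸ hTl i hi t
    simpa using transvection_mul_mem hi hij (Ne.symm hj) (hTl i hi t) (hlT j (Ne.symm hj) 1)
  have hDa : dilation l a ∈ G := by
    have h := mul_mem (hl0T (-b)) hH
    rwa [scaleAdd, ← mul_assoc, transvection_mul_transvection_same _ _ hl0, neg_add_cancel,
      transvection_zero, one_mul] at h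
  have hpow : ∀ k : ℕ, dilation l (a ^ k) ∈ G := by
    intro k
    induction k with
    | zero => simp [dilation_one]
    | succ k ih =>
      rw [pow_succ, ← dilation_mul_dilation]
      exact mul_mem ih hDa
  have hDl : ∀ s, dilation l s ∈ G := by
    intro s
    by_cases hs : s = 0
    · exact hs ▸ hD
    · obtain ⟨k, rfl⟩ := ha s hs
      exact hpow k
  refine eq_top_of_transvection_mem_of_dilation_mem hT fun i s ↦ ?_
  by_cases hi : i = l
  · exact hi ▸ hDl s
  · exact dilation_mem_of_dilation_mem (Ne.symm hi) (hT _ _ (Ne.symm hi)) (hT _ _ hi) (hDl s)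

end Generators

end Matrix

/-- For `n ≥ 2`, the multiplicative monoid of all `n × n` matrices over a finite field
(the general linear semigroup `GLS(n, F) = GL(n, F) ∪ Sing(n, F)`) is generated by
`n + 1` linear instructions. -/
theorem full_matrix_monoid_generated_by_n_plus_one_instructions
    (F : Type*) [Field F] [Fintype F] (n : ℕ) (hn : 2 ≤ n) :
    ∃ S : Finset (Matrix (Fin n) (Fin n) F),
      S.card = n + 1 ∧
      (∀ A ∈ S, A.IsLinearInstruction) ∧
      Submonoid.closure (S : Set (Matrix (Fin n) (Fin n) F)) = ⊤ := by
  classical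
  obtain ⟨m, rfl⟩ := Nat.exists_eq_add_of_le' hn
  obtain ⟨u, hu⟩ := IsCyclic.exists_monoid_generator (α := Fˣ)
  have ha : ∀ t : F, t ≠ 0 → ∃ k : ℕ, (u : F) ^ k = t := by
    intro t ht
    obtain ⟨k, hk⟩ := hu (Units.mk0 t ht)
    exact ⟨k, by simpa using congrArg Units.val hk⟩
  obtain ⟨b, hb⟩ : ∃ b : F, (u : F) = 1 ∧ b = 1 ∨ (u : F) ≠ 1 ∧ b = u * (u - 1) := by
    by_cases h : (u : F) = 1
    · exact ⟨1, .inl ⟨h, rfl⟩⟩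
    · exact ⟨_, .inr ⟨h, rfl⟩⟩
  have hb0 : b ≠ 0 := by
    obtain ⟨-, rfl⟩ | ⟨h, rfl⟩ := hb
    · exact one_ne_zero
    · exact mul_ne_zero u.ne_zero (sub_ne_zero.2 h)
  refine ⟨insert (dilation (Fin.last (m + 1)) 0) (Finset.univ.image (cyclicInstruction (u : F) b)),
    ?_, ?_, ?_⟩
  · rw [Finset.card_insert_of_notMem, Finset.card_image_of_injective _
      (cyclicInstruction_injective _ hb0), Finset.card_univ, Fintype.card_fin]
    simpa using fun i ↦ (dilation_ne_cyclicInstruction (u : F) hb0 _ i 0).symm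
  · intro A hA
    rw [Finset.mem_insert, Finset.mem_image] at hA
    rcases hA with rfl | ⟨i, -, rfl⟩
    · refine ⟨Fin.last (m + 1), fun j hj ↦ ?_⟩
      ext k
      simp [dilation, hj.symm]
    · exact ⟨i, fun j hj ↦ cyclicInstruction_apply_of_ne _ _ hj⟩
  · refine eq_top_of_cyclicInstruction_mem ha u.ne_zero hb (fun i ↦ ?_) ?_ <;>
      exact Submonoid.subset_closure (by simp)
end

section
/- Let F be a finite field and n ≥ 2. The all-ones n×n matrix over F cannot be written as a product of singular (non-invertible) matrices each differing from the n×n identity matrix in at most one row. (Indeed, every nonzero vector in the kernel of a singular linear instruction has at most one nonzero coordinate, so every product of singular linear instructions annihilates some standard basis vector, while the all-ones matrix annihilates no standard basis vector.) Hence the semigroup Sing(n,F) of singular matrices is not internally computable. -/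
open Matrix

/-- A singular linear instruction has a zero column: it annihilates a standard basis vector. -/
theorem Matrix.IsLinearInstruction.exists_col_eq_zero {F : Type*} [Field F] {n : ℕ}
    {A : Matrix (Fin n) (Fin n) F} (hA : A.IsLinearInstruction) (hs : ¬ IsUnit A) :
    ∃ i, ∀ j, A j i = 0 := by
  obtain ⟨i, hi⟩ := hA
  have hdet : A.det = 0 := by
    simpa [Matrix.isUnit_iff_isUnit_det] using hs
  obtain ⟨v, hv, hAv⟩ := Matrix.exists_mulVec_eq_zero_iff.mpr hdet
  have hv_off : ∀ j, j ≠ i → v j = 0 := by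
    intro j hj
    have h := congrFun hAv j
    rw [Matrix.mulVec, hi j hj] at h
    change ((1 : Matrix (Fin n) (Fin n) F) *ᵥ v) j = 0 at h
    rwa [Matrix.one_mulVec] at h
  have hvi : v i ≠ 0 := by
    intro h
    refine hv (funext fun j => ?_)
    by_cases hj : j = i
    · rw [hj, h, Pi.zero_apply]
    · exact hv_off j hj
  have hii : A i i * v i = 0 := by
    have h : ∑ k, A i k * v k = 0 := congrFun hAv i
    rwa [Finset.sum_eq_single i (fun k _ hk => by rw [hv_off k hk, mul_zero]) (by simp)] at h
  refine ⟨i, fun j => ?_⟩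
  by_cases hj : j = i
  · rw [hj]
    exact (mul_eq_zero.mp hii).resolve_right hvi
  · rw [hi j hj, Matrix.one_apply_ne hj]

/-- For `n ≥ 2`, the all-ones `n × n` matrix over a finite field is not a product of
singular linear instructions: the semigroup `Sing(n, F)` of singular matrices is not
internally computable. -/
theorem all_ones_not_product_of_singular_instructions
    (F : Type*) [Field F] [Fintype F] (n : ℕ) (hn : 2 ≤ n) :
    ¬ ∃ L : List (Matrix (Fin n) (Fin n) F),
        (∀ A ∈ L, ¬ IsUnit A ∧ A.IsLinearInstruction) ∧
        L.prod = Matrix.of (fun _ _ => (1 : F)) := by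
  rintro ⟨L, hL, hprod⟩
  rcases List.eq_nil_or_concat L with rfl | ⟨L', A, rfl⟩
  · have h := congrFun (congrFun hprod ⟨0, by omega⟩) ⟨1, by omega⟩
    simp at h
  · obtain ⟨hs, hA⟩ := hL A (by simp)
    obtain ⟨i, hi⟩ := hA.exists_col_eq_zero hs
    have h := congrFun (congrFun hprod i) i
    simp [Matrix.mul_apply, hi] at h
end
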